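/- arXiv:2508.14334 — 7 statements merged into one kernel-verified Lean document; each statement's English description precedes it below -/
import Mathlib

section
/- Let n and d be positive integers with d ≥ 2 and n ≥ 2(d+1), and let 𝓕 ⊆ binom([n], d+1) be a family of (d+1)-element subsets of [n] of maximum size among all such families with VC-dimension at most d. Then binom(n−1, d) + binom(n−4, d−2) ≤ |𝓕|, and there exists a constant C depending only on d such that |𝓕| ≤ binom(n−1, d) + C·n^{d−2}. -/
open Finset

/-- `S` is shattered by the family `𝓕`. -/
def Shatters' {n : ℕ} (𝓕 : Finset (Finset (Fin n))) (S : Finset (Fin n)) : Prop :=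
  ∀ A ⊆ S, ∃ F ∈ 𝓕, F ∩ S = A

/-- The VC-dimension of `𝓕` is at most `d`. -/
def VCDimLE {n : ℕ} (𝓕 : Finset (Finset (Fin n))) (d : ℕ) : Prop :=
  ∀ S : Finset (Fin n), Shatters' 𝓕 S → S.card ≤ d

/-- `T` is a `𝓖`-certificate of `F`: a proper subset of `F` such that no member of `𝓖`
meets `F` exactly in `T`. -/
def IsCert {n : ℕ} (𝓖 : Finset (Finset (Fin n))) (F T : Finset (Fin n)) : Prop :=
  T ⊂ F ∧ ∀ F' ∈ 𝓖, F' ∩ F ≠ T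

/-- `c` assigns to each member of `𝓖` a maximum `𝓖`-certificate. -/
def IsMaxCertAssignment {n : ℕ} (𝓖 : Finset (Finset (Fin n)))
    (c : Finset (Fin n) → Finset (Fin n)) : Prop :=
  ∀ F ∈ 𝓖, IsCert 𝓖 F (c F) ∧ ∀ T : Finset (Fin n), IsCert 𝓖 F T → T.card ≤ (c F).card

/-- The shadow `∂𝓗`: all sets obtained from a member of `𝓗` by removing one element. -/
def shadow' {n : ℕ} (𝓗 : Finset (Finset (Fin n))) : Finset (Finset (Fin n)) :=
  Finset.univ.filter (fun S => ∃ F ∈ 𝓗, S ⊆ F ∧ S.card + 1 = F.card)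

/-- `∂̄𝓗 = binom([n], d) \ ∂𝓗`. -/
def compShadow {n : ℕ} (d : ℕ) (𝓗 : Finset (Finset (Fin n))) : Finset (Finset (Fin n)) :=
  Finset.powersetCard d (Finset.univ : Finset (Fin n)) \ shadow' 𝓗

section lower_bound

variable {α : Type*} [DecidableEq α]

lemma inter_ne_erase_of_pair {d : ℕ} {F G : Finset α} (hF : #F = d + 1) (hG : #G = d + 1)
    {x y z : α} (hz : z ∈ F) (hxy : x ≠ y) (hx : x ∈ G) (hy : y ∈ G) (hxF : x ∉ F)
    (hyF : y ∉ F) : G ∩ F ≠ F.erase z := by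
  intro h
  have hsub : insert x (insert y (F.erase z)) ⊆ G :=
    insert_subset hx (insert_subset hy (h ▸ inter_subset_left))
  have := card_le_card hsub
  rw [card_insert_of_notMem (by simp [hxy, hxF]), card_insert_of_notMem (by simp [hyF]),
    card_erase_of_mem hz] at this
  omega

variable [Fintype α]

/-- The `(d + 1)`-sets that contain `o` but not `p`, or `p` and `a` but not `o`, or both `o` and `p`
and at least one of `a` and `b`. -/
def ahlswedeKhachatrian (d : ℕ) (o p a b : α) : Finset (Finset α) :=
  {F ∈ powersetCard (d + 1) univ | (o ∈ F ∧ p ∉ F) ∨ (o ∉ F ∧ p ∈ F ∧ a ∈ F) ∨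
    (o ∈ F ∧ p ∈ F ∧ (a ∈ F ∨ b ∈ F))}

lemma mem_ahlswedeKhachatrian {d : ℕ} {o p a b : α} {F : Finset α} :
    F ∈ ahlswedeKhachatrian d o p a b ↔ #F = d + 1 ∧ ((o ∈ F ∧ p ∉ F) ∨
      (o ∉ F ∧ p ∈ F ∧ a ∈ F) ∨ (o ∈ F ∧ p ∈ F ∧ (a ∈ F ∨ b ∈ F))) := by
  simp [ahlswedeKhachatrian, mem_powersetCard]

lemma exists_certificate_ahlswedeKhachatrian {d : ℕ} {o p a b : α} (hob : o ≠ b)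
    (hpa : p ≠ a) (hpb : p ≠ b) {F : Finset α}
    (hF : F ∈ ahlswedeKhachatrian d o p a b) :
    ∃ T ⊆ F, ∀ G ∈ ahlswedeKhachatrian d o p a b, G ∩ F ≠ T := by
  rw [mem_ahlswedeKhachatrian] at hF
  obtain ⟨hcard, hF⟩ := hF
  by_cases ho : o ∈ F
  · by_cases hp : p ∈ F
    · refine ⟨F \ {o, p}, sdiff_subset, fun G hG h ↦ ?_⟩
      rw [mem_ahlswedeKhachatrian] at hG
      have h1 := Finset.ext_iff.1 h o
      have h2 := Finset.ext_iff.1 h p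
      simp [ho, hp] at h1 h2
      tauto
    · by_cases ha : a ∈ F
      · refine ⟨F \ {o, a}, sdiff_subset, fun G hG h ↦ ?_⟩
        rw [mem_ahlswedeKhachatrian] at hG
        have h1 := Finset.ext_iff.1 h o
        have h2 := Finset.ext_iff.1 h a
        simp [ho, ha] at h1 h2
        tauto
      · refine ⟨F.erase o, erase_subset _ _, fun G hG h ↦ ?_⟩
        rw [mem_ahlswedeKhachatrian] at hG
        have h1 := Finset.ext_iff.1 h o
        simp [ho] at h1
        exact inter_ne_erase_of_pair hcard hG.1 ho hpa (by tauto) (by tauto) hp ha h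
  · have hpa' : p ∈ F ∧ a ∈ F := by tauto
    by_cases hb : b ∈ F
    · refine ⟨F \ {a, b}, sdiff_subset, fun G hG h ↦ ?_⟩
      rw [mem_ahlswedeKhachatrian] at hG
      have h1 := Finset.ext_iff.1 h a
      have h2 := Finset.ext_iff.1 h b
      have h3 := Finset.ext_iff.1 h p
      simp [hpa', hb, hpa, hpb] at h1 h2 h3
      tauto
    · refine ⟨F.erase a, erase_subset _ _, fun G hG h ↦ ?_⟩
      rw [mem_ahlswedeKhachatrian] at hG
      have h1 := Finset.ext_iff.1 h a
      have h3 := Finset.ext_iff.1 h p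
      simp [hpa', hpa] at h1 h3
      exact inter_ne_erase_of_pair hcard hG.1 hpa'.2 hob (by tauto) (by tauto) ho hb h

lemma card_image_union_powersetCard (k : ℕ) {X Y : Finset α} (h : X ⊆ Y) :
    #((powersetCard k (univ \ Y)).image (X ∪ ·)) = (Fintype.card α - #Y).choose k := by
  rw [card_image_of_injOn, card_powersetCard, card_sdiff_of_subset (subset_univ _), card_univ]
  intro S hS T hT hST
  simp only [mem_coe, mem_powersetCard, subset_sdiff] at hS hT
  have hS' := hS.1.2.symm.mono_left h
  have hT' := hT.1.2.symm.mono_left h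
  have := congrArg (· \ X) hST
  simpa only [union_sdiff_cancel_left hS', union_sdiff_cancel_left hT'] using this

lemma le_card_ahlswedeKhachatrian {d : ℕ} (hd : 2 ≤ d) {o p a b : α} (hop : o ≠ p) (hoa : o ≠ a)
    (hob : o ≠ b) (hpa : p ≠ a) (hpb : p ≠ b) (hab : a ≠ b) :
    (Fintype.card α - 1).choose d + (Fintype.card α - 4).choose (d - 2) ≤
      #(ahlswedeKhachatrian d o p a b) := by
  obtain ⟨e, rfl⟩ : ∃ e, d = e + 2 := ⟨d - 2, by omega⟩
  have h4 : 4 ≤ Fintype.card α := by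
    have := card_le_univ ({o, p, a, b} : Finset α)
    rwa [card_insert_of_notMem (by simp [*]), card_insert_of_notMem (by simp [*]),
      card_pair hab] at this
  have hc2 : #({o, p} : Finset α) = 2 := card_pair hop
  have hc3 : #({o, p, a} : Finset α) = 3 := by
    rw [card_insert_of_notMem (by simp [*]), card_pair hpa]
  have hc4 : #({o, p, a, b} : Finset α) = 4 := by
    rw [card_insert_of_notMem (by simp [*]), card_insert_of_notMem (by simp [*]), card_pair hab]
  set A₁ := (powersetCard (e + 2) (univ \ {o, p})).image (({o} : Finset α) ∪ ·) with hA₁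
  set A₂ := (powersetCard (e + 1) (univ \ {o, p, a})).image (({p, a} : Finset α) ∪ ·) with hA₂
  set A₃ := (powersetCard e (univ \ {o, p, a})).image (({o, p, a} : Finset α) ∪ ·) with hA₃
  set A₄ := (powersetCard e (univ \ {o, p, a, b})).image (({o, p, b} : Finset α) ∪ ·) with hA₄
  have m₁ : ∀ F ∈ A₁, #F = e + 3 ∧ o ∈ F ∧ p ∉ F := by
    simp only [hA₁, mem_image, mem_powersetCard, subset_sdiff, forall_exists_index, and_imp]
    rintro F S - hdis hS rfl
    simp only [disjoint_insert_right, disjoint_singleton_right] at hdis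
    rw [card_union_of_disjoint (by simp [hdis])]
    simp [hS, hdis, hop.symm]
    omega
  have m₂ : ∀ F ∈ A₂, #F = e + 3 ∧ o ∉ F ∧ p ∈ F ∧ a ∈ F := by
    simp only [hA₂, mem_image, mem_powersetCard, subset_sdiff, forall_exists_index, and_imp]
    rintro F S - hdis hS rfl
    simp only [disjoint_insert_right, disjoint_singleton_right] at hdis
    rw [card_union_of_disjoint (by simp [hdis]), card_pair hpa]
    simp [hS, hdis, hop, hoa]
    omega
  have m₃ : ∀ F ∈ A₃, #F = e + 3 ∧ o ∈ F ∧ p ∈ F ∧ a ∈ F := by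
    simp only [hA₃, mem_image, mem_powersetCard, subset_sdiff, forall_exists_index, and_imp]
    rintro F S - hdis hS rfl
    simp only [disjoint_insert_right, disjoint_singleton_right] at hdis
    rw [card_union_of_disjoint (by simp [hdis]), hc3]
    simp [hS]
    omega
  have m₄ : ∀ F ∈ A₄, #F = e + 3 ∧ o ∈ F ∧ p ∈ F ∧ a ∉ F ∧ b ∈ F := by
    simp only [hA₄, mem_image, mem_powersetCard, subset_sdiff, forall_exists_index, and_imp]
    rintro F S - hdis hS rfl
    simp only [disjoint_insert_right, disjoint_singleton_right] at hdis
    rw [card_union_of_disjoint (by simp [hdis]),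
      card_insert_of_notMem (by simp [*]), card_pair hpb]
    simp [hS, hdis, hoa.symm, hpa.symm, hab]
    omega
  have d₁ : Disjoint A₁ A₂ := disjoint_left.2 fun F h h' ↦ (m₂ F h').2.1 (m₁ F h).2.1
  have d₂ : Disjoint (A₁ ∪ A₂) A₃ := disjoint_left.2 fun F h h' ↦ by
    have := m₃ F h'
    rcases mem_union.1 h with h | h
    · exact (m₁ F h).2.2 this.2.2.1
    · exact (m₂ F h).2.1 this.2.1
  have d₃ : Disjoint (A₁ ∪ A₂ ∪ A₃) A₄ := disjoint_left.2 fun F h h' ↦ by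
    have := m₄ F h'
    rcases mem_union.1 h with h | h
    · rcases mem_union.1 h with h | h
      · exact (m₁ F h).2.2 this.2.2.1
      · exact (m₂ F h).2.1 this.2.1
    · exact this.2.2.2.1 (m₃ F h).2.2.2
  have hsub : A₁ ∪ A₂ ∪ A₃ ∪ A₄ ⊆ ahlswedeKhachatrian (e + 2) o p a b := by
    intro F hF
    rw [mem_ahlswedeKhachatrian]
    simp only [mem_union] at hF
    rcases hF with ((h | h) | h) | h
    · have := m₁ F h; tauto
    · have := m₂ F h; tauto
    · have := m₃ F h; tauto
    · have := m₄ F h; tauto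
  refine le_trans (le_of_eq ?_) (card_le_card hsub)
  rw [card_union_of_disjoint d₃, card_union_of_disjoint d₂, card_union_of_disjoint d₁, hA₁, hA₂,
    hA₃, hA₄, card_image_union_powersetCard _ (by simp), card_image_union_powersetCard _ (by simp),
    card_image_union_powersetCard _ (by simp),
    card_image_union_powersetCard _ (by intro x; simp; tauto), hc2, hc3, hc4]
  obtain ⟨m, hm⟩ : ∃ m, Fintype.card α = m + 4 := ⟨_, (Nat.sub_add_cancel h4).symm⟩
  simp only [hm, show m + 4 - 1 = m + 3 by omega, show m + 4 - 2 = m + 2 by omega,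
    show m + 4 - 3 = m + 1 by omega, show m + 4 - 4 = m by omega, show e + 2 - 2 = e by omega,
    Nat.choose_succ_succ' (m + 2) (e + 1), Nat.choose_succ_succ' (m + 1) e]
  ring

end lower_bound

section structure_of_families

variable {α : Type*} [DecidableEq α]

open Classical in
/-- A member of `𝓕` that contains `T` and avoids `X`, if there is one. -/
noncomputable def avoider (𝓕 : Finset (Finset α)) (T X : Finset α) : Finset α :=
  if h : ∃ G ∈ 𝓕, T ⊆ G ∧ Disjoint X G then h.choose else ∅

lemma avoider_spec {𝓕 : Finset (Finset α)} {T X : Finset α}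
    (h : ∃ G ∈ 𝓕, T ⊆ G ∧ Disjoint X G) :
    avoider 𝓕 T X ∈ 𝓕 ∧ T ⊆ avoider 𝓕 T X ∧ Disjoint X (avoider 𝓕 T X) := by
  rw [avoider, dif_pos h]
  exact h.choose_spec

lemma card_avoider_le {𝓕 : Finset (Finset α)} {r : ℕ} (h𝓕 : ∀ F ∈ 𝓕, #F = r)
    (T X : Finset α) : #(avoider 𝓕 T X) ≤ r := by
  by_cases h : ∃ G ∈ 𝓕, T ⊆ G ∧ Disjoint X G
  · exact (h𝓕 _ (avoider_spec h).1).le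
  · simp [avoider, dif_neg h]

/-- Adds to `S` the chosen members of `𝓕` that contain `T` and avoid a subset of `S`. -/
noncomputable def expand (𝓕 : Finset (Finset α)) (T S : Finset α) : Finset α :=
  S ∪ S.powerset.biUnion (avoider 𝓕 T)

lemma subset_expand (𝓕 : Finset (Finset α)) (T S : Finset α) : S ⊆ expand 𝓕 T S :=
  subset_union_left

lemma card_expand_le {𝓕 : Finset (Finset α)} {r s : ℕ} (h𝓕 : ∀ F ∈ 𝓕, #F = r)
    (T : Finset α) {S : Finset α} (hS : #S ≤ s) : #(expand 𝓕 T S) ≤ s + 2 ^ s * r := by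
  refine (card_union_le _ _).trans (Nat.add_le_add hS ?_)
  refine (card_biUnion_le_card_mul _ _ r fun X _ ↦ card_avoider_le h𝓕 T X).trans ?_
  rw [card_powerset]
  gcongr
  norm_num

lemma exists_mem_expand {𝓕 : Finset (Finset α)} {F T S X : Finset α} (hTF : T ⊆ F)
    (hT : ∀ G ∈ 𝓕, G ∩ F ≠ T) (hXS : X ⊆ S) (hX : ∃ G ∈ 𝓕, T ⊆ G ∧ Disjoint X G) :
    ∃ b ∈ F, b ∉ T ∧ b ∉ X ∧ b ∈ expand 𝓕 T S := by
  obtain ⟨h1, h2, h3⟩ := avoider_spec hX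
  have hss : T ⊂ avoider 𝓕 T X ∩ F :=
    (subset_inter h2 hTF).ssubset_of_ne (hT _ h1).symm
  obtain ⟨b, hb, hbT⟩ := exists_of_ssubset hss
  rw [mem_inter] at hb
  refine ⟨b, hb.2, hbT, fun hbX ↦ disjoint_left.1 h3 hbX hb.1, ?_⟩
  exact mem_union_right _ (mem_biUnion.2 ⟨X, mem_powerset.2 hXS, hb.1⟩)

/-- A bounded set of candidates for the elements that a member of `𝓕` with certificate `T`
has outside `T`. -/
noncomputable def candidates (𝓕 : Finset (Finset α)) (Q : Finset α) : Finset α :=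
  Q.powerset.biUnion fun T ↦ expand 𝓕 T (expand 𝓕 T (expand 𝓕 T ∅))

/-- A bound for the number of candidates over a set with at most `r` elements. -/
def candidateBound (r : ℕ) : ℕ :=
  2 ^ r * (r + 2 ^ r * r + 2 ^ (r + 2 ^ r * r) * r)

lemma card_candidates_le {𝓕 : Finset (Finset α)} {r : ℕ} (h𝓕 : ∀ F ∈ 𝓕, #F = r)
    {Q : Finset α} (hQ : #Q ≤ r) : #(candidates 𝓕 Q) ≤ candidateBound r := by
  refine (card_biUnion_le_card_mul _ _ (r + 2 ^ r * r + 2 ^ (r + 2 ^ r * r) * r)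
    fun T _ ↦ ?_).trans ?_
  · refine card_expand_le h𝓕 T (card_expand_le h𝓕 T ?_)
    simpa using card_expand_le h𝓕 T (S := ∅) (s := 0) (by simp)
  · rw [card_powerset, candidateBound]
    gcongr
    norm_num

lemma exists_nonstar_certificate {𝓕 : Finset (Finset α)} {d : ℕ} (h𝓕 : ∀ F ∈ 𝓕, #F = d + 1)
    {F : Finset α} (hF : F ∈ 𝓕) (hcert : ∃ T ⊆ F, ∀ G ∈ 𝓕, G ∩ F ≠ T)
    (hown : ∀ D ⊆ F, #D = d → ∃ G ∈ 𝓕, D ⊆ G ∧ G ≠ F) :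
    ∃ T ⊆ F, (∀ G ∈ 𝓕, G ∩ F ≠ T) ∧ ∀ x ∉ T, ∃ G ∈ 𝓕, T ⊆ G ∧ x ∉ G := by
  classical
  obtain ⟨T, hT, hmax⟩ := exists_max_image
    (F.powerset.filter fun T ↦ ∀ G ∈ 𝓕, G ∩ F ≠ T) card
    (by obtain ⟨T, h1, h2⟩ := hcert; exact ⟨T, by simpa using ⟨h1, h2⟩⟩)
  simp only [mem_filter, mem_powerset] at hT hmax
  obtain ⟨hTF, hT⟩ := hT
  refine ⟨T, hTF, hT, fun x hx ↦ ?_⟩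
  by_cases hxF : x ∈ F
  swap
  · exact ⟨F, hF, hTF, hxF⟩
  by_contra! hstar
  have hTne : T ≠ F := fun h ↦ hT F hF (by simp [h])
  have hcard : #T < #F := card_lt_card (hTF.ssubset_of_ne hTne)
  have hTd : #T ≠ d := by
    intro hd
    obtain ⟨G, hG, hTG, hne⟩ := hown T hTF hd
    have h1 : #T < #(G ∩ F) :=
      card_lt_card ((subset_inter hTG hTF).ssubset_of_ne (hT G hG).symm)
    have h2 : G ∩ F = F :=
      eq_of_subset_of_card_le inter_subset_right (by rw [h𝓕 F hF]; omega)
    exact hne (eq_of_subset_of_card_le (inter_eq_right.1 h2)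
      (by rw [h𝓕 F hF, h𝓕 G hG])).symm
  rw [h𝓕 F hF] at hcard
  have hxT : #(insert x T) < #F := by
    rw [card_insert_of_notMem hx, h𝓕 F hF]; omega
  obtain ⟨y, hyF, hy⟩ := exists_mem_notMem_of_card_lt_card hxT
  simp only [mem_insert, not_or] at hy
  have := hmax (insert y T) ⟨insert_subset hyF hTF, fun G hG hGF ↦ ?_⟩
  · rw [card_insert_of_notMem hy.2] at this; omega
  · have hTG : T ⊆ G := (subset_insert y T).trans (hGF ▸ inter_subset_left)
    have : x ∈ insert y T := hGF ▸ mem_inter.2 ⟨hstar G hG hTG, hxF⟩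
    rw [mem_insert] at this
    exact this.elim (fun h ↦ hy.1 h.symm) hx

lemma exists_pair_or_triple {𝓕 : Finset (Finset α)} {F T : Finset α} (hF : F ∈ 𝓕)
    (hTF : T ⊆ F) (hT : ∀ G ∈ 𝓕, G ∩ F ≠ T) (hstar : ∀ x ∉ T, ∃ G ∈ 𝓕, T ⊆ G ∧ x ∉ G) :
    ∃ x ∈ F, ∃ y ∈ F, x ≠ y ∧ {x, y} ⊆ candidates 𝓕 (F \ {x, y}) ∧
      ((∀ G ∈ 𝓕, F \ {x, y} ⊆ G → x ∈ G ∨ y ∈ G) ∨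
        ∃ z ∈ F, z ≠ x ∧ z ≠ y ∧ {x, y, z} ⊆ candidates 𝓕 (F \ {x, y, z})) := by
  have hcand {b : α} {X : Finset α} (hXT : Disjoint T X)
      (hb : b ∈ expand 𝓕 T (expand 𝓕 T (expand 𝓕 T ∅))) : b ∈ candidates 𝓕 (F \ X) :=
    mem_biUnion.2 ⟨T, mem_powerset.2 (subset_sdiff.2 ⟨hTF, hXT⟩), hb⟩
  obtain ⟨x, hxF, hxT, -, hx⟩ := exists_mem_expand (S := ∅) hTF hT (empty_subset ∅)
    ⟨F, hF, hTF, disjoint_empty_left F⟩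
  obtain ⟨G, hG, hTG, hxG⟩ := hstar x hxT
  obtain ⟨y, hyF, hyT, hyx, hy⟩ := exists_mem_expand hTF hT (singleton_subset_iff.2 hx)
    ⟨G, hG, hTG, disjoint_singleton_left.2 hxG⟩
  rw [mem_singleton] at hyx
  have hx2 := subset_expand 𝓕 T _ hx
  refine ⟨x, hxF, y, hyF, Ne.symm hyx, ?_, ?_⟩
  · have hdisj : Disjoint T {x, y} := by simp [hxT, hyT]
    simp only [insert_subset_iff, singleton_subset_iff]
    exact ⟨hcand hdisj (subset_expand _ _ _ hx2), hcand hdisj (subset_expand _ _ _ hy)⟩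
  by_cases hcov : ∃ G ∈ 𝓕, T ⊆ G ∧ Disjoint {x, y} G
  · right
    obtain ⟨z, hzF, hzT, hzxy, hz⟩ := exists_mem_expand (S := expand 𝓕 T (expand 𝓕 T ∅)) hTF hT
      (by simp [insert_subset_iff, hx2, hy]) hcov
    simp only [mem_insert, mem_singleton, not_or] at hzxy
    have hdisj : Disjoint T {x, y, z} := by simp [hxT, hyT, hzT]
    refine ⟨z, hzF, hzxy.1, hzxy.2, ?_⟩
    simp only [insert_subset_iff, singleton_subset_iff]
    exact ⟨hcand hdisj (subset_expand _ _ _ hx2), hcand hdisj (subset_expand _ _ _ hy),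
      hcand hdisj hz⟩
  · left
    intro G hG hGF
    by_contra! hn
    refine hcov ⟨G, hG, (subset_sdiff.2 ⟨hTF, ?_⟩).trans hGF, ?_⟩
    · simp [hxT, hyT]
    · simp [hn.1, hn.2]

lemma card_le_of_forall_exists_union [Fintype α] {𝓢 : Finset (Finset α)}
    {W : Finset α → Finset α} {k K : ℕ} (hW : ∀ Q, #Q = k → #(W Q) ≤ K)
    (h : ∀ F ∈ 𝓢, ∃ Q, #Q = k ∧ ∃ X ⊆ W Q, F = Q ∪ X) :
    #𝓢 ≤ Fintype.card α ^ k * 2 ^ K := by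
  have hsub : 𝓢 ⊆ (powersetCard k univ).biUnion fun Q ↦ (W Q).powerset.image (Q ∪ ·) := by
    intro F hF
    obtain ⟨Q, hQ, X, hX, rfl⟩ := h F hF
    exact mem_biUnion.2 ⟨Q, mem_powersetCard.2 ⟨subset_univ _, hQ⟩,
      mem_image.2 ⟨X, mem_powerset.2 hX, rfl⟩⟩
  refine (card_le_card hsub).trans ((card_biUnion_le_card_mul _ _ (2 ^ K) fun Q hQ ↦ ?_).trans ?_)
  · refine card_image_le.trans ?_
    rw [card_powerset]
    exact Nat.pow_le_pow_right (by norm_num) (hW Q (mem_powersetCard.1 hQ).2)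
  · rw [card_powersetCard, card_univ]
    gcongr
    exact Nat.choose_le_pow _ _

end structure_of_families

section crossings

variable {α : Type*} [DecidableEq α]

/-- Two members `P ∪ {x, x', v}` and `P ∪ {x, x', v'}` of `𝓕`, covered by the pairs `{x, v}` and
`{x', v'}` respectively. -/
structure Crossing (𝓕 : Finset (Finset α)) (W : Finset α → Finset α) (P : Finset α)
    (v x x' v' : α) : Prop where
  notMem : v ∉ P ∧ x ∉ P ∧ x' ∉ P ∧ v' ∉ P
  ne : x ≠ v ∧ x' ≠ v ∧ v' ≠ v ∧ x ≠ x' ∧ x ≠ v' ∧ x' ≠ v'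
  mem : x ∈ W (insert x' P) ∧ v ∈ W (insert x' P)
  mem' : x' ∈ W (insert x P) ∧ v' ∈ W (insert x P)
  cover : ∀ G ∈ 𝓕, insert x' P ⊆ G → x ∈ G ∨ v ∈ G
  cover' : ∀ G ∈ 𝓕, insert x P ⊆ G → x' ∈ G ∨ v' ∈ G

variable {𝓕 : Finset (Finset α)} {W : Finset α → Finset α} {e K : ℕ}

lemma Crossing.not_subset (h𝓕 : ∀ F ∈ 𝓕, #F = e + 3) {P : Finset α} (hP : #P = e)
    {v x y z s t u : α} (h : Crossing 𝓕 W P v x y z) (h' : Crossing 𝓕 W P v s t u)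
    (hs : s ∉ ({x, y, z} : Finset α)) (ht : t ∉ ({x, y, z} : Finset α)) {G : Finset α}
    (hG : G ∈ 𝓕) : ¬ insert x (insert t P) ⊆ G := by
  intro hsub
  simp only [mem_insert, mem_singleton, not_or] at hs ht
  obtain ⟨a, haG, ha⟩ : ∃ a ∈ G, a = y ∨ a = z := by
    rcases h.cover' G hG ((insert_subset_insert x (subset_insert t P)).trans hsub) with h | h
    exacts [⟨y, h, .inl rfl⟩, ⟨z, h, .inr rfl⟩]
  obtain ⟨b, hbG, hb⟩ : ∃ b ∈ G, b = s ∨ b = v := by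
    rcases h'.cover G hG ((subset_insert x _).trans hsub) with h | h
    exacts [⟨s, h, .inl rfl⟩, ⟨v, h, .inr rfl⟩]
  have n₁ := h.notMem
  have n₂ := h'.notMem
  have e₁ := h.ne
  have e₂ := h'.ne
  have hsub' : insert a (insert b (insert x (insert t P))) ⊆ G :=
    insert_subset haG (insert_subset hbG hsub)
  have hcard := card_le_card hsub'
  rw [card_insert_of_notMem (by simp only [mem_insert, not_or]; grind),
    card_insert_of_notMem (by simp only [mem_insert, not_or]; grind),
    card_insert_of_notMem (by simp only [mem_insert, not_or]; grind),
    card_insert_of_notMem (by grind), h𝓕 G hG] at hcard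
  omega

variable [Fintype α]

open Classical in
/-- The pairs `(x, x')` that occur in a crossing at `(P, v)`. -/
noncomputable def crossingPairs (𝓕 : Finset (Finset α)) (W : Finset α → Finset α)
    (q : Finset α × α) : Finset (α × α) :=
  {p | ∃ v', Crossing 𝓕 W q.1 q.2 p.1 p.2 v'}

lemma mem_crossingPairs {q : Finset α × α} {p : α × α} :
    p ∈ crossingPairs 𝓕 W q ↔ ∃ v', Crossing 𝓕 W q.1 q.2 p.1 p.2 v' := by
  simp [crossingPairs]

lemma card_filter_crossingPairs_le (hW : ∀ Q, #Q ≤ e + 3 → #(W Q) ≤ K) {q : Finset α × α}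
    (hP : #q.1 = e) (x y z : α) :
    #{p ∈ crossingPairs 𝓕 W q | p.1 ∈ ({x, y, z} : Finset α) ∨ p.2 ∈ ({x, y, z} : Finset α)} ≤
      6 * K := by
  have hK (s : α) : #(W (insert s q.1)) ≤ K := hW _ ((card_insert_le _ _).trans (by omega))
  have hsub : {p ∈ crossingPairs 𝓕 W q |
      p.1 ∈ ({x, y, z} : Finset α) ∨ p.2 ∈ ({x, y, z} : Finset α)} ⊆
      (({x, y, z} : Finset α).biUnion fun s ↦ (W (insert s q.1)).image fun t ↦ (s, t)) ∪
      (({x, y, z} : Finset α).biUnion fun t ↦ (W (insert t q.1)).image fun s ↦ (s, t)) := by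
    rintro ⟨s, t⟩ hp
    rw [mem_filter, mem_crossingPairs] at hp
    obtain ⟨⟨v', hv'⟩, hs | ht⟩ := hp
    · exact mem_union_left _ (mem_biUnion.2 ⟨s, hs, mem_image_of_mem _ hv'.mem'.1⟩)
    · exact mem_union_right _ (mem_biUnion.2 ⟨t, ht, mem_image.2 ⟨s, hv'.mem.1, rfl⟩⟩)
  have h₁ := card_biUnion_le_card_mul ({x, y, z} : Finset α)
    (fun s ↦ (W (insert s q.1)).image fun t ↦ (s, t)) K fun s _ ↦ card_image_le.trans (hK s)
  have h₂ := card_biUnion_le_card_mul ({x, y, z} : Finset α)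
    (fun t ↦ (W (insert t q.1)).image fun s ↦ (s, t)) K fun s _ ↦ card_image_le.trans (hK s)
  have h₃ : #({x, y, z} : Finset α) * K ≤ 3 * K := Nat.mul_le_mul_right K card_le_three
  have := (card_le_card hsub).trans (card_union_le _ _)
  omega

open Classical in
/-- The pairs of crossings at `(P, v)` to which `Crossing.not_subset` applies. -/
noncomputable def compatiblePairs (𝓕 : Finset (Finset α)) (W : Finset α → Finset α)
    (q : Finset α × α) : Finset ((α × α) × (α × α)) :=
  {r ∈ crossingPairs 𝓕 W q ×ˢ crossingPairs 𝓕 W q |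
    r.1.1 ≠ r.2.2 ∧ ∀ G ∈ 𝓕, ¬ insert r.1.1 (insert r.2.2 q.1) ⊆ G}

lemma le_card_compatiblePairs (h𝓕 : ∀ F ∈ 𝓕, #F = e + 3) (hW : ∀ Q, #Q ≤ e + 3 → #(W Q) ≤ K)
    {q : Finset α × α} (hP : #q.1 = e) :
    #(crossingPairs 𝓕 W q) * (#(crossingPairs 𝓕 W q) - 6 * K) ≤ #(compatiblePairs 𝓕 W q) := by
  classical
  have hex : ∀ p : α × α, ∃ v', p ∈ crossingPairs 𝓕 W q → Crossing 𝓕 W q.1 q.2 p.1 p.2 v' :=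
    fun p ↦ by
      by_cases hp : p ∈ crossingPairs 𝓕 W q
      · exact (mem_crossingPairs.1 hp).imp fun _ h _ ↦ h
      · exact ⟨p.1, fun h ↦ absurd h hp⟩
  choose u hu using hex
  have hsub : ((crossingPairs 𝓕 W q).sigma fun p ↦ {p' ∈ crossingPairs 𝓕 W q |
      ¬ (p'.1 ∈ ({p.1, p.2, u p} : Finset α) ∨ p'.2 ∈ ({p.1, p.2, u p} : Finset α))}).image
      (fun s ↦ (s.1, s.2)) ⊆ compatiblePairs 𝓕 W q := by
    rintro ⟨p, p'⟩ h
    simp only [mem_image, mem_sigma, Sigma.exists, Prod.mk.injEq] at h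
    obtain ⟨p, p', ⟨hp, hp'⟩, rfl, rfl⟩ := h
    rw [mem_filter, not_or] at hp'
    rw [compatiblePairs, mem_filter, mem_product]
    refine ⟨⟨hp, hp'.1⟩, fun h ↦ hp'.2.2 (mem_insert.2 (.inl h.symm)), fun G hG ↦ ?_⟩
    exact (hu p hp).not_subset h𝓕 hP (hu p' hp'.1) hp'.2.1 hp'.2.2 hG
  refine le_trans ?_ (card_le_card hsub)
  rw [card_image_of_injOn, card_sigma]
  · rw [← smul_eq_mul]
    refine card_nsmul_le_sum _ _ _ fun p _ ↦ ?_
    have h₁ := card_filter_crossingPairs_le (𝓕 := 𝓕) hW hP p.1 p.2 (u p)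
    have h₂ := card_filter_add_card_filter_not (s := crossingPairs 𝓕 W q)
      (fun p' ↦ p'.1 ∈ ({p.1, p.2, u p} : Finset α) ∨ p'.2 ∈ ({p.1, p.2, u p} : Finset α))
    omega
  · rintro ⟨a, b⟩ - ⟨c, d⟩ - h
    simp only [Prod.mk.injEq] at h
    obtain ⟨rfl, rfl⟩ := h
    rfl

/-- The sets of size `d` contained in no member of `𝓕`. -/
def isolated (𝓕 : Finset (Finset α)) (d : ℕ) : Finset (Finset α) :=
  {D ∈ powersetCard d univ | ∀ G ∈ 𝓕, ¬ D ⊆ G}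

lemma sum_card_compatiblePairs_le (hW : ∀ Q, #Q ≤ e + 3 → #(W Q) ≤ K) :
    ∑ q ∈ powersetCard e univ ×ˢ univ, #(compatiblePairs 𝓕 W q) ≤
      ((e + 2) * (e + 2) * K ^ 3) * #(isolated 𝓕 (e + 2)) := by
  classical
  rw [← card_sigma]
  refine card_le_mul_card_image_of_maps_to (f := fun s : (_ : Finset α × α) × (α × α) × (α × α) ↦
    insert s.2.1.1 (insert s.2.2.2 s.1.1)) ?_ _ ?_
  · rintro ⟨⟨P, v⟩, ⟨x, y⟩, ⟨s, t⟩⟩ h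
    simp only [mem_sigma, mem_product, mem_powersetCard, compatiblePairs, mem_filter,
      mem_crossingPairs] at h
    obtain ⟨⟨⟨-, hP⟩, -⟩, ⟨⟨z, hz⟩, u, hu⟩, hne, hG⟩ := h
    rw [isolated, mem_filter, mem_powersetCard]
    refine ⟨⟨subset_univ _, ?_⟩, hG⟩
    rw [card_insert_of_notMem (by simp [hne, hz.notMem]), card_insert_of_notMem (hu.notMem.2.2.1),
      hP]
  · intro D hD
    rw [isolated, mem_filter, mem_powersetCard] at hD
    have hDe := hD.1.2
    have hsub : {s ∈ (powersetCard e univ ×ˢ univ).sigma (compatiblePairs 𝓕 W) |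
        insert s.2.1.1 (insert s.2.2.2 s.1.1) = D} ⊆
        (D ×ˢ D).biUnion fun p ↦
          (W (insert p.2 (D \ {p.1, p.2})) ×ˢ W (insert p.2 (D \ {p.1, p.2})) ×ˢ
            W (insert p.1 (D \ {p.1, p.2}))).image
            fun w ↦ ⟨(D \ {p.1, p.2}, w.1), (p.1, w.2.2), (w.2.1, p.2)⟩ := by
      rintro ⟨⟨P, v⟩, ⟨x, y⟩, ⟨s, t⟩⟩ h
      simp only [mem_sigma, mem_product, mem_powersetCard, compatiblePairs, mem_filter,
        mem_crossingPairs] at h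
      obtain ⟨⟨⟨⟨-, hP⟩, -⟩, ⟨⟨z, hz⟩, u, hu⟩, hne, hG⟩, rfl⟩ := h
      have hPD : insert x (insert t P) \ {x, t} = P := by
        have := hz.notMem
        have := hu.notMem
        ext a
        simp only [mem_sdiff, mem_insert, mem_singleton]
        grind
      refine mem_biUnion.2 ⟨(x, t), by simp, mem_image.2 ⟨(v, s, y), ?_, ?_⟩⟩
      · simp only [hPD, mem_product]
        exact ⟨hu.mem.2, hu.mem.1, hz.mem'.1⟩
      · simp only [hPD]
    have hK (p : α × α) (a : α) (ha : a ∈ D) : #(W (insert a (D \ {p.1, p.2}))) ≤ K :=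
      hW _ ((card_le_card (insert_subset ha sdiff_subset)).trans (by omega))
    refine (card_le_card hsub).trans ((card_biUnion_le_card_mul _ _ (K ^ 3) fun p hp ↦ ?_).trans ?_)
    · rw [mem_product] at hp
      refine card_image_le.trans ?_
      rw [card_product, card_product]
      calc _ ≤ K * (K * K) :=
            Nat.mul_le_mul (hK p _ hp.2) (Nat.mul_le_mul (hK p _ hp.2) (hK p _ hp.1))
        _ = K ^ 3 := by ring
    · rw [card_product, hDe]

/-- A bound on the number of crossings at a typical pair `(P, v)`. -/
def crossingBound (e K : ℕ) : ℕ := 6 * K + 2 * ((e + 2) * (e + 2) * K ^ 3 + 1)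

lemma two_mul_sum_card_crossingPairs_le (h𝓕 : ∀ F ∈ 𝓕, #F = e + 3)
    (hW : ∀ Q, #Q ≤ e + 3 → #(W Q) ≤ K) :
    2 * ∑ q ∈ powersetCard e univ ×ˢ univ with crossingBound e K < #(crossingPairs 𝓕 W q),
      #(crossingPairs 𝓕 W q) ≤ #(isolated 𝓕 (e + 2)) := by
  set B := (e + 2) * (e + 2) * K ^ 3 + 1 with hB
  refine Nat.le_of_mul_le_mul_left (c := B) ?_ (by omega)
  calc B * (2 * ∑ q ∈ powersetCard e univ ×ˢ univ with crossingBound e K < #(crossingPairs 𝓕 W q),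
        #(crossingPairs 𝓕 W q))
      = ∑ q ∈ powersetCard e univ ×ˢ univ with crossingBound e K < #(crossingPairs 𝓕 W q),
        #(crossingPairs 𝓕 W q) * (2 * B) := by rw [← sum_mul]; ring
    _ ≤ ∑ q ∈ powersetCard e univ ×ˢ univ with crossingBound e K < #(crossingPairs 𝓕 W q),
        #(compatiblePairs 𝓕 W q) := by
      refine sum_le_sum fun q hq ↦ ?_
      simp only [mem_filter, mem_product, mem_powersetCard, crossingBound, ← hB] at hq
      refine le_trans (Nat.mul_le_mul_left _ ?_) (le_card_compatiblePairs h𝓕 hW hq.1.1.2)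
      omega
    _ ≤ ∑ q ∈ powersetCard e univ ×ˢ univ, #(compatiblePairs 𝓕 W q) :=
      sum_le_sum_of_subset (filter_subset _ _)
    _ ≤ (B - 1) * #(isolated 𝓕 (e + 2)) := sum_card_compatiblePairs_le hW
    _ ≤ B * #(isolated 𝓕 (e + 2)) := Nat.mul_le_mul_right _ (by omega)

end crossings

section own_subsets

variable {α : Type*}

/-- `c G` is an own `d`-subset of each `G ∈ 𝓖`: no other member of `𝓕` contains it. -/
structure OwnSubsets (𝓕 𝓖 : Finset (Finset α)) (d : ℕ) (c : Finset α → Finset α) : Prop where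
  subset_family : 𝓖 ⊆ 𝓕
  subset : ∀ G ∈ 𝓖, c G ⊆ G
  card_eq : ∀ G ∈ 𝓖, #(c G) = d
  eq_of_subset : ∀ G ∈ 𝓖, ∀ F ∈ 𝓕, c G ⊆ F → F = G

variable {𝓕 𝓖 : Finset (Finset α)} {W c : Finset α → Finset α} {d e : ℕ}

lemma OwnSubsets.injOn (hc : OwnSubsets 𝓕 𝓖 d c) : Set.InjOn c 𝓖 := fun G hG G' hG' h ↦
  hc.eq_of_subset G' hG' G (hc.subset_family hG) (h ▸ hc.subset G hG)

variable [DecidableEq α]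

lemma OwnSubsets.mem_of_image_subset (hc : OwnSubsets 𝓕 𝓖 d c) {D F : Finset α}
    (hD : D ∈ 𝓖.image c) (hF : F ∈ 𝓕) (hDF : D ⊆ F) : F ∈ 𝓖 ∧ D = c F := by
  obtain ⟨G, hG, rfl⟩ := mem_image.1 hD
  obtain rfl := hc.eq_of_subset G hG F hF hDF
  exact ⟨hG, rfl⟩

/-- `F ∉ 𝓖` is covered by the pair `{x, v}`, and replacing that pair by `w` gives the own subset of
a member of `𝓖` that contains `v`. -/
structure Route (𝓕 𝓖 : Finset (Finset α)) (W c : Finset α → Finset α) (F : Finset α)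
    (w x v : α) : Prop where
  mem : F ∈ 𝓕
  notMem : F ∉ 𝓖
  w_notMem : w ∉ F
  x_mem : x ∈ F
  v_mem : v ∈ F
  ne : x ≠ v
  x_mem_W : x ∈ W (F \ {x, v})
  v_mem_W : v ∈ W (F \ {x, v})
  cover : ∀ G ∈ 𝓕, F \ {x, v} ⊆ G → x ∈ G ∨ v ∈ G
  own : ∃ G ∈ 𝓖, c G = insert w (F \ {x, v}) ∧ v ∈ G

lemma Route.insert_erase_notMem (hc : OwnSubsets 𝓕 𝓖 d c) {F : Finset α} {w x v : α}
    (h : Route 𝓕 𝓖 W c F w x v) : insert w (F.erase v) ∉ 𝓕 := by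
  intro hF
  obtain ⟨G, hG, hcG, hv⟩ := h.own
  have hsub : c G ⊆ insert w (F.erase v) := by
    rw [hcG]
    exact insert_subset_insert w fun a ha ↦ by
      simp only [mem_sdiff, mem_insert, mem_singleton, not_or] at ha
      exact mem_erase.2 ⟨ha.2.2, ha.1⟩
  rw [← hc.eq_of_subset G hG _ hF hsub, mem_insert, mem_erase] at hv
  rcases hv with rfl | hv
  · exact h.w_notMem h.v_mem
  · exact hv.1 rfl

lemma Route.erase_notMem_image (hc : OwnSubsets 𝓕 𝓖 d c) {F : Finset α} {w x v : α}
    (h : Route 𝓕 𝓖 W c F w x v) : F.erase v ∉ 𝓖.image c :=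
  fun hF ↦ h.notMem (hc.mem_of_image_subset hF h.mem (erase_subset _ _)).1

lemma Route.exists_crossing (h𝓕 : ∀ F ∈ 𝓕, #F = e + 3) (hc : OwnSubsets 𝓕 𝓖 (e + 2) c)
    {F F' : Finset α} {w x v x' v' : α} (h : Route 𝓕 𝓖 W c F w x v)
    (h' : Route 𝓕 𝓖 W c F' w x' v') (heq : F.erase v = F'.erase v') (hne : F ≠ F') :
    ∃ P, #P = e ∧ Crossing 𝓕 W P v x x' v' ∧ F = insert x (insert x' (insert v P)) ∧
      w ∉ insert v P ∧ insert w (insert v P) ∉ 𝓖.image c := by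
  obtain ⟨G, hG, hcG, hvG⟩ := h.own
  obtain ⟨G', hG', hcG', hvG'⟩ := h'.own
  have hvv : v ≠ v' := by
    rintro rfl
    exact hne (by rw [← insert_erase h.v_mem, heq, insert_erase h'.v_mem])
  have hw := h.w_notMem
  have hw' := h'.w_notMem
  have hx := h.x_mem
  have hx' := h'.x_mem
  have hv := h.v_mem
  have hv' := h'.v_mem
  have hxv := h.ne
  have hxv' := h'.ne
  have hmem (a : α) : (a ≠ v ∧ a ∈ F) ↔ (a ≠ v' ∧ a ∈ F') := by
    simpa only [mem_erase] using Finset.ext_iff.1 heq a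
  have hxx : x ≠ x' := by
    rintro rfl
    have hsd : F \ {x, v} = F' \ {x, v'} := by
      ext a
      have := hmem a
      simp only [mem_sdiff, mem_insert, mem_singleton]
      tauto
    have hGG : G = G' := hc.injOn hG hG' (by rw [hcG, hcG', hsd])
    subst hGG
    have hsub : insert v (insert v' (c G)) ⊆ G :=
      insert_subset hvG (insert_subset hvG' (hc.subset G hG))
    have hcard := card_le_card hsub
    rw [card_insert_of_notMem, card_insert_of_notMem, hc.card_eq G hG,
      h𝓕 G (hc.subset_family hG)] at hcard
    · omega
    · rw [hcG']; simp only [mem_insert, mem_sdiff, mem_singleton]; grind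
    · rw [hcG]; simp only [mem_insert, mem_sdiff, mem_singleton]; grind
  have hx'F := (hmem x').2 ⟨hxv', hx'⟩
  have hxF' := (hmem x).1 ⟨hxv, hx⟩
  set P := F \ {x, x', v} with hP
  have hP₁ : F \ {x, v} = insert x' P := by
    ext a
    simp only [hP, mem_sdiff, mem_insert, mem_singleton]
    grind
  have hP₂ : F' \ {x', v'} = insert x P := by
    ext a
    have := hmem a
    simp only [hP, mem_sdiff, mem_insert, mem_singleton]
    grind
  have hFP : F = insert x (insert x' (insert v P)) := by
    ext a
    simp only [hP, mem_sdiff, mem_insert, mem_singleton]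
    grind
  have hnP : v ∉ P ∧ x ∉ P ∧ x' ∉ P ∧ v' ∉ P := by
    have := hmem v'
    simp only [hP, mem_sdiff, mem_insert, mem_singleton]
    grind
  have hwP : w ∉ P := fun h ↦ hw (sdiff_subset h)
  have hwv : w ≠ v := fun h ↦ hw (h ▸ hv)
  have hcP : #P = e := by
    have hcard := h𝓕 F h.mem
    rw [hFP, card_insert_of_notMem (by simp [hxx, hxv, hnP]),
      card_insert_of_notMem (by simp [hx'F.1, hnP]), card_insert_of_notMem hnP.1] at hcard
    omega
  refine ⟨P, hcP, ⟨hnP, ⟨hxv, hx'F.1, hvv.symm, hxx, hxF'.1, hxv'⟩, ?_, ?_, ?_, ?_⟩, hFP,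
    by simp [hwP, hwv], fun him ↦ ?_⟩
  · rw [← hP₁]; exact ⟨h.x_mem_W, h.v_mem_W⟩
  · rw [← hP₂]; exact ⟨h'.x_mem_W, h'.v_mem_W⟩
  · rw [← hP₁]; exact h.cover
  · rw [← hP₂]; exact h'.cover
  · have hsub : insert w (insert x' P) ⊆ G := by
      rw [← hP₁, ← hcG]; exact hc.subset G hG
    have hvc := (hc.mem_of_image_subset him (hc.subset_family hG)
      (insert_subset (hsub (mem_insert_self _ _)) (insert_subset hvG
        (((subset_insert _ _).trans (subset_insert _ _)).trans hsub)))).2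
    rw [hcG, hP₁] at hvc
    have : v ∈ insert w (insert x' P) := hvc ▸ by simp
    simp only [mem_insert] at this
    grind

lemma exists_route (hc : OwnSubsets 𝓕 𝓖 d c) {F : Finset α}
    (hF : F ∈ 𝓕) (hF' : F ∉ 𝓖) {x y w : α} (hx : x ∈ F) (hy : y ∈ F) (hxy : x ≠ y)
    (hW : {x, y} ⊆ W (F \ {x, y})) (hcov : ∀ G ∈ 𝓕, F \ {x, y} ⊆ G → x ∈ G ∨ y ∈ G)
    (hw : w ∉ F) (hown : insert w (F \ {x, y}) ∈ 𝓖.image c) :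
    ∃ s v, Route 𝓕 𝓖 W c F w s v := by
  obtain ⟨G, hG, hcG⟩ := mem_image.1 hown
  simp only [insert_subset_iff, singleton_subset_iff] at hW
  rcases hcov G (hc.subset_family hG)
    ((subset_insert w _).trans (hcG ▸ hc.subset G hG)) with h | h
  · have hyx : ({y, x} : Finset α) = {x, y} := pair_comm y x
    exact ⟨y, x, hF, hF', hw, hy, hx, hxy.symm, hyx ▸ hW.2, hyx ▸ hW.1,
      fun G hG h ↦ (hcov G hG (hyx ▸ h)).symm, G, hG, hyx ▸ hcG, h⟩
  · exact ⟨x, y, hF, hF', hw, hx, hy, hxy, hW.1, hW.2, hcov, G, hG, hcG, h⟩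

end own_subsets

section collisions

variable {α : Type*} [DecidableEq α] [Fintype α]

/-- The elements that extend `insert v P`, where `q = (P, v)`, to a member of `𝓜`. -/
def extensions (𝓜 : Finset (Finset α)) (q : Finset α × α) : Finset α :=
  {w | w ∉ insert q.2 q.1 ∧ insert w (insert q.2 q.1) ∈ 𝓜}

lemma mem_extensions {𝓜 : Finset (Finset α)} {q : Finset α × α} {w : α} :
    w ∈ extensions 𝓜 q ↔ w ∉ insert q.2 q.1 ∧ insert w (insert q.2 q.1) ∈ 𝓜 := by
  simp [extensions]

lemma sum_card_extensions_le {𝓜 : Finset (Finset α)} {e : ℕ} (h𝓜 : ∀ D ∈ 𝓜, #D = e + 2) :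
    ∑ q ∈ powersetCard e univ ×ˢ univ, #(extensions 𝓜 q) ≤ (e + 2) * (e + 2) * #𝓜 := by
  rw [← card_sigma]
  refine card_le_mul_card_image_of_maps_to (f := fun s : (_ : Finset α × α) × α ↦
    insert s.2 (insert s.1.2 s.1.1)) ?_ _ ?_
  · rintro ⟨q, w⟩ h
    exact (mem_extensions.1 (mem_sigma.1 h).2).2
  · intro D hD
    have hsub : {s ∈ (powersetCard e univ ×ˢ univ).sigma (extensions 𝓜) |
        insert s.2 (insert s.1.2 s.1.1) = D} ⊆
        (D ×ˢ D).image fun p ↦ ⟨((D.erase p.1).erase p.2, p.2), p.1⟩ := by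
      rintro ⟨⟨P, v⟩, w⟩ h
      simp only [mem_filter, mem_sigma, mem_product, mem_powersetCard, mem_extensions] at h
      obtain ⟨⟨⟨⟨-, hP⟩, -⟩, hw, -⟩, rfl⟩ := h
      have hv : v ∉ P := by
        intro hv
        have := h𝓜 _ hD
        rw [insert_eq_of_mem hv] at this
        have := card_insert_le w P
        omega
      refine mem_image.2 ⟨(w, v), by simp, ?_⟩
      simp only [erase_insert hw, erase_insert hv]
    refine (card_le_card hsub).trans (card_image_le.trans ?_)
    rw [card_product, h𝓜 D hD]

variable {𝓕 𝓖 : Finset (Finset α)} {W c : Finset α → Finset α} {e K : ℕ}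

lemma card_collisions_le_sum (h𝓕 : ∀ F ∈ 𝓕, #F = e + 3) (hc : OwnSubsets 𝓕 𝓖 (e + 2) c)
    {𝓟 : Finset (Finset α × α)} {x v : Finset α × α → α}
    (h𝓟 : ∀ p ∈ 𝓟, Route 𝓕 𝓖 W c p.1 p.2 (x p) (v p)) :
    #{p ∈ 𝓟 | ∃ p' ∈ 𝓟, p' ≠ p ∧ p'.1.erase (v p') = p.1.erase (v p) ∧ p'.2 = p.2} ≤
      ∑ q ∈ powersetCard e univ ×ˢ univ, #(crossingPairs 𝓕 W q) *
        #(extensions (powersetCard (e + 2) univ \ 𝓖.image c) q) := by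
  simp_rw [← card_product]
  rw [← card_sigma]
  refine (card_le_card ?_).trans (card_image_le (f :=
    fun s : (_ : Finset α × α) × ((α × α) × α) ↦
      (insert s.2.1.1 (insert s.2.1.2 (insert s.1.2 s.1.1)), s.2.2)))
  intro p hp
  simp only [mem_filter] at hp
  obtain ⟨hp, p', hp', hne, heq, hw⟩ := hp
  have hr' := h𝓟 p' hp'
  rw [hw] at hr'
  obtain ⟨P, hP, hcr, hF, hwP, him⟩ := (h𝓟 p hp).exists_crossing h𝓕 hc hr' heq.symm
    fun h ↦ hne (Prod.ext h.symm hw)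
  refine mem_image.2 ⟨⟨(P, v p), (x p, x p'), p.2⟩, ?_, Prod.ext hF.symm rfl⟩
  simp only [mem_sigma, mem_product, mem_powersetCard, mem_univ, subset_univ, true_and, and_true,
    mem_crossingPairs, mem_extensions, mem_sdiff]
  refine ⟨hP, ⟨_, hcr⟩, hwP, ?_, him⟩
  rw [card_insert_of_notMem hwP, card_insert_of_notMem hcr.notMem.1, hP]

lemma card_collisions_le (h𝓕 : ∀ F ∈ 𝓕, #F = e + 3) (hc : OwnSubsets 𝓕 𝓖 (e + 2) c)
    (hW : ∀ Q, #Q ≤ e + 3 → #(W Q) ≤ K) (hα : 2 * (e + 3) ≤ Fintype.card α)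
    {𝓟 : Finset (Finset α × α)} {x v : Finset α × α → α}
    (h𝓟 : ∀ p ∈ 𝓟, Route 𝓕 𝓖 W c p.1 p.2 (x p) (v p)) :
    #{p ∈ 𝓟 | ∃ p' ∈ 𝓟, p' ≠ p ∧ p'.1.erase (v p') = p.1.erase (v p) ∧ p'.2 = p.2} ≤
      crossingBound e K * ((e + 2) * (e + 2) * #(powersetCard (e + 2) univ \ 𝓖.image c)) +
        (Fintype.card α - (e + 2)) * #(isolated 𝓕 (e + 2)) := by
  set 𝓜 := powersetCard (e + 2) univ \ 𝓖.image c with h𝓜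
  have hsum : ∑ q ∈ powersetCard e univ ×ˢ univ,
      #(crossingPairs 𝓕 W q) * #(extensions 𝓜 q) ≤
      ∑ q ∈ powersetCard e univ ×ˢ univ, (crossingBound e K * #(extensions 𝓜 q) +
        if crossingBound e K < #(crossingPairs 𝓕 W q) then
          #(crossingPairs 𝓕 W q) * Fintype.card α else 0) := by
    refine sum_le_sum fun q _ ↦ ?_
    split_ifs with h
    · exact (Nat.mul_le_mul_left _ (card_le_univ _)).trans (Nat.le_add_left _ _)
    · exact (Nat.mul_le_mul_right _ (not_lt.1 h)).trans (Nat.le_add_right _ _)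
  refine (card_collisions_le_sum h𝓕 hc h𝓟).trans (hsum.trans ?_)
  rw [sum_add_distrib, ← mul_sum, ← sum_filter, ← sum_mul]
  refine Nat.add_le_add (Nat.mul_le_mul_left _ (sum_card_extensions_le fun D hD ↦
    (mem_powersetCard.1 (mem_sdiff.1 hD).1).2)) ?_
  refine le_trans ?_ (Nat.mul_le_mul_left _ (two_mul_sum_card_crossingPairs_le h𝓕 hW))
  rw [mul_comm, ← mul_assoc]
  exact Nat.mul_le_mul_right _ (by omega)

end collisions

section double_counting

variable {α : Type*} [DecidableEq α] [Fintype α]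

/-- The pairs of a member of `𝓧` and an element outside it. -/
def nonincidences (𝓧 : Finset (Finset α)) : Finset (Finset α × α) :=
  {p ∈ 𝓧 ×ˢ univ | p.2 ∉ p.1}

lemma mem_nonincidences {𝓧 : Finset (Finset α)} {p : Finset α × α} :
    p ∈ nonincidences 𝓧 ↔ p.1 ∈ 𝓧 ∧ p.2 ∉ p.1 := by
  simp [nonincidences]

lemma card_nonincidences {𝓧 : Finset (Finset α)} {d : ℕ} (h : ∀ D ∈ 𝓧, #D = d) :
    #(nonincidences 𝓧) = (Fintype.card α - d) * #𝓧 := by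
  rw [mul_comm, card_eq_sum_card_fiberwise (f := Prod.fst) (t := 𝓧)
    fun p hp ↦ (mem_nonincidences.1 hp).1, ← smul_eq_mul]
  refine sum_eq_card_nsmul fun D hD ↦ ?_
  have : {p ∈ nonincidences 𝓧 | p.1 = D} = Dᶜ.image fun w ↦ (D, w) := by
    ext ⟨E, w⟩
    simp only [mem_filter, mem_nonincidences, mem_image, mem_compl, Prod.mk.injEq]
    constructor
    · rintro ⟨⟨-, hw⟩, rfl⟩
      exact ⟨w, hw, rfl, rfl⟩
    · rintro ⟨a, ha, rfl, rfl⟩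
      exact ⟨⟨hD, ha⟩, rfl⟩
  rw [this, card_image_of_injective _ (Prod.mk_right_injective D), card_compl, h D hD]

variable {𝓕 𝓖 : Finset (Finset α)} {W c : Finset α → Finset α} {d : ℕ}

lemma card_mul_card_add_card_le (h𝓕 : ∀ F ∈ 𝓕, #F = d + 1) (hc : OwnSubsets 𝓕 𝓖 d c)
    (hα : d + 1 ≤ Fintype.card α) {𝓟 : Finset (Finset α × α)} {x v : Finset α × α → α}
    (h𝓟 : ∀ p ∈ 𝓟, Route 𝓕 𝓖 W c p.1 p.2 (x p) (v p)) :
    Fintype.card α * #𝓖 + #𝓟 + (Fintype.card α - d) * #(isolated 𝓕 d) ≤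
      Fintype.card α * (Fintype.card α - 1).choose d +
        #{p ∈ 𝓟 | ∃ p' ∈ 𝓟, p' ≠ p ∧ p'.1.erase (v p') = p.1.erase (v p) ∧ p'.2 = p.2} := by
  set 𝓒 := {p ∈ 𝓟 | ∃ p' ∈ 𝓟, p' ≠ p ∧ p'.1.erase (v p') = p.1.erase (v p) ∧ p'.2 = p.2} with h𝓒
  set Φ : Finset α × α → Finset α × α := fun p ↦ (p.1.erase (v p), p.2) with hΦ
  set A := nonincidences (𝓖.image c ∪ isolated 𝓕 d) with hA
  set B := (𝓖.sigma c).image fun s ↦ (s.1.erase s.2, s.2) with hB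
  set C := (𝓟 \ 𝓒).image Φ with hC
  have mB : ∀ p ∈ B, p.2 ∉ p.1 ∧ insert p.2 p.1 ∈ 𝓖 ∧ p.2 ∈ c (insert p.2 p.1) := by
    intro p hp
    obtain ⟨⟨G, w⟩, hs, rfl⟩ := mem_image.1 hp
    rw [mem_sigma] at hs
    simp only at hs ⊢
    rw [insert_erase (hc.subset G hs.1 hs.2)]
    exact ⟨notMem_erase _ _, hs⟩
  have mC : ∀ p ∈ C, p.2 ∉ p.1 ∧ p.1 ∉ 𝓖.image c ∧ insert p.2 p.1 ∉ 𝓕 ∧ #p.1 = d ∧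
      ∃ F ∈ 𝓕, p.1 ⊆ F := by
    intro p hp
    obtain ⟨s, hs, rfl⟩ := mem_image.1 hp
    have hr := h𝓟 s (mem_sdiff.1 hs).1
    refine ⟨fun h ↦ hr.w_notMem (erase_subset _ _ h), hr.erase_notMem_image hc,
      hr.insert_erase_notMem hc, ?_, s.1, hr.mem, erase_subset _ _⟩
    rw [card_erase_of_mem hr.v_mem, h𝓕 _ hr.mem, Nat.add_sub_cancel]
  have hO : ∀ D ∈ 𝓖.image c, #D = d ∧ ∃ F ∈ 𝓕, D ⊆ F := by
    intro D hD
    obtain ⟨G, hG, rfl⟩ := mem_image.1 hD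
    exact ⟨hc.card_eq G hG, G, hc.subset_family hG, hc.subset G hG⟩
  have hI : ∀ D ∈ isolated 𝓕 d, #D = d ∧ ∀ F ∈ 𝓕, ¬ D ⊆ F := by
    intro D hD
    rw [isolated, mem_filter, mem_powersetCard] at hD
    exact ⟨hD.1.2, hD.2⟩
  have cA : #A = (Fintype.card α - d) * (#𝓖 + #(isolated 𝓕 d)) := by
    rw [hA, card_nonincidences (d := d), card_union_of_disjoint, card_image_of_injOn hc.injOn]
    · exact disjoint_left.2 fun D h h' ↦
        let ⟨F, hF, hDF⟩ := (hO D h).2; (hI D h').2 F hF hDF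
    · exact fun D hD ↦ (mem_union.1 hD).elim (fun h ↦ (hO D h).1) fun h ↦ (hI D h).1
  have cB : #B = d * #𝓖 := by
    rw [hB, card_image_of_injOn, card_sigma, sum_congr rfl hc.card_eq, sum_const, smul_eq_mul,
      mul_comm]
    rintro ⟨G, w⟩ h ⟨G', w'⟩ h' heq
    simp only [mem_coe, mem_sigma] at h h'
    simp only [Prod.mk.injEq] at heq
    obtain ⟨heq, rfl⟩ := heq
    have : G = G' := by
      rw [← insert_erase (hc.subset G h.1 h.2), heq, insert_erase (hc.subset G' h'.1 h'.2)]
    rw [this]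
  have cC : #C + #𝓒 = #𝓟 := by
    rw [hC, card_image_of_injOn, card_sdiff_add_card_eq_card (filter_subset _ _)]
    intro p hp p' hp' heq
    simp only [coe_sdiff, Set.mem_sdiff, mem_coe] at hp hp'
    by_contra hne
    simp only [hΦ, Prod.mk.injEq] at heq
    exact hp'.2 (mem_filter.2 ⟨hp'.1, p, hp.1, hne, heq.1, heq.2⟩)
  have dAB : Disjoint A B := by
    refine disjoint_left.2 fun p h h' ↦ ?_
    obtain ⟨hw, hG, hwc⟩ := mB p h'
    rcases mem_union.1 (mem_nonincidences.1 h).1 with h | h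
    · have := (hc.mem_of_image_subset h (hc.subset_family hG) (subset_insert _ _)).2
      exact hw (this ▸ hwc)
    · exact (hI _ h).2 _ (hc.subset_family hG) (subset_insert _ _)
  have dABC : Disjoint (A ∪ B) C := by
    refine disjoint_left.2 fun p h h' ↦ ?_
    obtain ⟨-, hO', hF, -, F, hF', hpF⟩ := mC p h'
    rcases mem_union.1 h with h | h
    · rcases mem_union.1 (mem_nonincidences.1 h).1 with h | h
      · exact hO' h
      · exact (hI _ h).2 F hF' hpF
    · exact hF (hc.subset_family (mB p h).2.1)
  have hsub : A ∪ B ∪ C ⊆ nonincidences (powersetCard d univ) := by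
    intro p hp
    rw [mem_nonincidences, mem_powersetCard_univ]
    rcases mem_union.1 hp with h | h
    · rcases mem_union.1 h with h | h
      · rw [mem_nonincidences] at h
        exact ⟨(mem_union.1 h.1).elim (fun h ↦ (hO _ h).1) fun h ↦ (hI _ h).1, h.2⟩
      · obtain ⟨hw, hG, -⟩ := mB p h
        have := h𝓕 _ (hc.subset_family hG)
        rw [card_insert_of_notMem hw] at this
        exact ⟨by omega, hw⟩
    · exact ⟨(mC p h).2.2.2.1, (mC p h).1⟩
  have hcard := card_le_card hsub
  rw [card_union_of_disjoint dABC, card_union_of_disjoint dAB, cA, cB,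
    card_nonincidences fun D hD ↦ (mem_powersetCard.1 hD).2, card_powersetCard, card_univ] at hcard
  obtain ⟨m, hm⟩ : ∃ m, Fintype.card α = m + 1 := ⟨_, (Nat.sub_add_cancel (by omega)).symm⟩
  have hch := Nat.choose_mul_succ_eq m d
  have h₁ : Fintype.card α * #𝓖 = (Fintype.card α - d) * #𝓖 + d * #𝓖 := by
    rw [← add_mul, Nat.sub_add_cancel (by omega)]
  have h₂ : Fintype.card α * (Fintype.card α - 1).choose d =
      (Fintype.card α - d) * (Fintype.card α).choose d := by
    rw [hm, Nat.add_sub_cancel, mul_comm, hch, mul_comm]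
  rw [mul_add] at hcard
  omega

end double_counting

section upper_bound

variable {α : Type*} [DecidableEq α] [Fintype α]

lemma card_filter_nonincidences_le {𝓗 𝓜 : Finset (Finset α)} {W : Finset α → Finset α} {d K : ℕ}
    (hW : ∀ Q, #Q ≤ d + 1 → #(W Q) ≤ K) (h𝓜 : ∀ D ∈ 𝓜, #D = d) {X : Finset α → Finset α}
    (hX : ∀ F ∈ 𝓗, X F ⊆ F ∧ X F ⊆ W (F \ X F)) :
    #{p ∈ nonincidences 𝓗 | insert p.2 (p.1 \ X p.1) ∈ 𝓜} ≤ #𝓜 * (d * 2 ^ K) := by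
  have hsub : {p ∈ nonincidences 𝓗 | insert p.2 (p.1 \ X p.1) ∈ 𝓜} ⊆
      𝓜.biUnion fun D ↦ D.biUnion fun w ↦
        (W (D.erase w)).powerset.image fun Y ↦ (D.erase w ∪ Y, w) := by
    rintro ⟨F, w⟩ hp
    simp only [mem_filter, mem_nonincidences] at hp
    obtain ⟨⟨hF, hw⟩, hD⟩ := hp
    refine mem_biUnion.2 ⟨_, hD, mem_biUnion.2 ⟨w, mem_insert_self _ _, mem_image.2 ⟨X F, ?_, ?_⟩⟩⟩
    · rw [erase_insert fun h ↦ hw (sdiff_subset h), mem_powerset]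
      exact (hX F hF).2
    · rw [erase_insert fun h ↦ hw (sdiff_subset h), sdiff_union_of_subset (hX F hF).1]
  refine (card_le_card hsub).trans (card_biUnion_le_card_mul _ _ _ fun D hD ↦ ?_)
  rw [← h𝓜 D hD]
  refine card_biUnion_le_card_mul _ _ _ fun w _ ↦ card_image_le.trans ?_
  rw [card_powerset]
  refine Nat.pow_le_pow_right (by norm_num) (hW _ ?_)
  exact (card_le_card (erase_subset _ _)).trans (by rw [h𝓜 D hD]; omega)

lemma exists_ownSubsets {𝓕 : Finset (Finset α)} (d : ℕ) :
    ∃ 𝓖 c, OwnSubsets 𝓕 𝓖 d c ∧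
      ∀ F ∈ 𝓕, F ∉ 𝓖 → ∀ D ⊆ F, #D = d → ∃ G ∈ 𝓕, D ⊆ G ∧ G ≠ F := by
  classical
  have hex : ∀ F, ∃ D, (∃ D ⊆ F, #D = d ∧ ∀ G ∈ 𝓕, D ⊆ G → G = F) →
      D ⊆ F ∧ #D = d ∧ ∀ G ∈ 𝓕, D ⊆ G → G = F := fun F ↦ by
    by_cases h : ∃ D ⊆ F, #D = d ∧ ∀ G ∈ 𝓕, D ⊆ G → G = F
    · exact h.imp fun _ h _ ↦ h
    · exact ⟨∅, fun h' ↦ absurd h' h⟩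
  choose c hc using hex
  refine ⟨{F ∈ 𝓕 | ∃ D ⊆ F, #D = d ∧ ∀ G ∈ 𝓕, D ⊆ G → G = F}, c, ⟨filter_subset _ _, ?_, ?_, ?_⟩,
    ?_⟩
  · exact fun G hG ↦ (hc G (mem_filter.1 hG).2).1
  · exact fun G hG ↦ (hc G (mem_filter.1 hG).2).2.1
  · exact fun G hG ↦ (hc G (mem_filter.1 hG).2).2.2
  · intro F hF hF' D hD hDd
    by_contra! h
    exact hF' (mem_filter.2 ⟨hF, D, hD, hDd, h⟩)

/-- The constant in the upper bound for families of `(e + 3)`-sets. -/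
def upperConstant (e : ℕ) : ℕ :=
  let K := candidateBound (e + 3)
  (e + 3) * 2 ^ K +
    (1 + 2 ^ K) * ((e + 2) * 2 ^ K + crossingBound e K * ((e + 2) * (e + 2))) + 2 ^ K

lemma card_le_choose_add {𝓕 : Finset (Finset α)} {e : ℕ} (h𝓕 : ∀ F ∈ 𝓕, #F = e + 3)
    (hcert : ∀ F ∈ 𝓕, ∃ T ⊆ F, ∀ G ∈ 𝓕, G ∩ F ≠ T) (hα : 2 * (e + 3) ≤ Fintype.card α)
    (hlarge : (Fintype.card α - 1).choose (e + 2) ≤ #𝓕) :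
    #𝓕 ≤ (Fintype.card α - 1).choose (e + 2) + upperConstant e * Fintype.card α ^ e := by
  classical
  set n := Fintype.card α with hn
  set K := candidateBound (e + 3) with hK
  set W := candidates 𝓕
  have hW : ∀ Q, #Q ≤ e + 3 → #(W Q) ≤ K := fun Q hQ ↦ card_candidates_le h𝓕 hQ
  obtain ⟨𝓖, c, hc, hown⟩ := exists_ownSubsets (𝓕 := 𝓕) (e + 2)
  have hpt : ∀ F ∈ 𝓕 \ 𝓖, ∃ x ∈ F, ∃ y ∈ F, x ≠ y ∧ {x, y} ⊆ W (F \ {x, y}) ∧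
      ((∀ G ∈ 𝓕, F \ {x, y} ⊆ G → x ∈ G ∨ y ∈ G) ∨
        ∃ z ∈ F, z ≠ x ∧ z ≠ y ∧ {x, y, z} ⊆ W (F \ {x, y, z})) := by
    intro F hF
    rw [mem_sdiff] at hF
    obtain ⟨T, hTF, hT, hstar⟩ :=
      exists_nonstar_certificate h𝓕 hF.1 (hcert F hF.1) (hown F hF.1 hF.2)
    exact exists_pair_or_triple hF.1 hTF hT hstar
  set 𝓗 := 𝓕 \ 𝓖 with h𝓗
  set 𝓗₁ := {F ∈ 𝓗 | ∃ x ∈ F, ∃ y ∈ F, x ≠ y ∧ {x, y} ⊆ W (F \ {x, y}) ∧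
    ∀ G ∈ 𝓕, F \ {x, y} ⊆ G → x ∈ G ∨ y ∈ G} with h𝓗₁
  have h𝓗F : ∀ F ∈ 𝓗, F ∈ 𝓕 := fun F hF ↦ (mem_sdiff.1 hF).1
  have card_𝓗 : #𝓗 ≤ n ^ (e + 1) * 2 ^ K := by
    refine card_le_of_forall_exists_union (W := W) (fun Q hQ ↦ hW Q (by omega)) fun F hF ↦ ?_
    obtain ⟨x, hx, y, hy, hxy, hxyW, -⟩ := hpt F hF
    have hsub : {x, y} ⊆ F := by simp [insert_subset_iff, hx, hy]
    refine ⟨F \ {x, y}, ?_, {x, y}, hxyW, (sdiff_union_of_subset hsub).symm⟩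
    rw [card_sdiff_of_subset hsub, card_pair hxy, h𝓕 F (h𝓗F F hF)]
    omega
  have card_𝓗₀ : #(𝓗 \ 𝓗₁) ≤ n ^ e * 2 ^ K := by
    refine card_le_of_forall_exists_union (W := W) (fun Q hQ ↦ hW Q (by omega)) fun F hF ↦ ?_
    rw [mem_sdiff] at hF
    obtain ⟨x, hx, y, hy, hxy, hxyW, hcov | ⟨z, hz, hzx, hzy, hzW⟩⟩ := hpt F hF.1
    · exact absurd (mem_filter.2 ⟨hF.1, x, hx, y, hy, hxy, hxyW, hcov⟩) hF.2
    have hsub : {x, y, z} ⊆ F := by simp [insert_subset_iff, hx, hy, hz]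
    refine ⟨F \ {x, y, z}, ?_, {x, y, z}, hzW, (sdiff_union_of_subset hsub).symm⟩
    rw [card_sdiff_of_subset hsub, card_insert_of_notMem (by simp [hxy, hzx.symm]),
      card_pair hzy.symm, h𝓕 F (h𝓗F F hF.1)]
    omega
  have : Nonempty α := Fintype.card_pos_iff.1 (by omega)
  have hpair : ∀ F ∈ 𝓗₁, ∃ x ∈ F, ∃ y ∈ F, x ≠ y ∧ {x, y} ⊆ W (F \ {x, y}) ∧
    ∀ G ∈ 𝓕, F \ {x, y} ⊆ G → x ∈ G ∨ y ∈ G := fun F hF ↦ (mem_filter.1 hF).2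
  choose! x hx y hy hxy hxyW hcov using hpair
  set 𝓜 := powersetCard (e + 2) univ \ 𝓖.image c with h𝓜
  set 𝓟 := {p ∈ nonincidences 𝓗₁ | insert p.2 (p.1 \ {x p.1, y p.1}) ∉ 𝓜} with h𝓟
  have card_insert {F : Finset α} {w : α} (hF : F ∈ 𝓗₁) (hw : w ∉ F) :
      #(insert w (F \ {x F, y F})) = e + 2 := by
    rw [card_insert_of_notMem fun h ↦ hw (sdiff_subset h),
      card_sdiff_of_subset (by simp [insert_subset_iff, hx F hF, hy F hF]),
      card_pair (hxy F hF), h𝓕 F (h𝓗F F (mem_filter.1 hF).1)]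
    omega
  have hroute : ∀ p ∈ 𝓟, ∃ s v, Route 𝓕 𝓖 W c p.1 p.2 s v := by
    rintro ⟨F, w⟩ hp
    simp only [h𝓟, mem_filter, mem_nonincidences] at hp
    obtain ⟨⟨hF, hw⟩, hM⟩ := hp
    have hF' := mem_sdiff.1 (mem_filter.1 hF).1
    refine exists_route hc hF'.1 hF'.2 (hx F hF) (hy F hF) (hxy F hF) (hxyW F hF) (hcov F hF) hw ?_
    by_contra him
    exact hM (mem_sdiff.2 ⟨mem_powersetCard.2 ⟨subset_univ _, card_insert hF hw⟩, him⟩)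
  choose! s v hsv using hroute
  have card_𝓟 : (n - (e + 3)) * #𝓗₁ ≤ #𝓟 + #𝓜 * ((e + 2) * 2 ^ K) := by
    rw [← card_nonincidences (d := e + 3) fun F hF ↦ h𝓕 F (h𝓗F F (mem_filter.1 hF).1),
      ← card_filter_add_card_filter_not (s := nonincidences 𝓗₁)
        (fun p ↦ insert p.2 (p.1 \ {x p.1, y p.1}) ∈ 𝓜), add_comm]
    refine Nat.add_le_add_left (card_filter_nonincidences_le (X := fun F ↦ {x F, y F}) hW
      (fun D hD ↦ (mem_powersetCard.1 (mem_sdiff.1 hD).1).2) fun F hF ↦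
      ⟨by simp [insert_subset_iff, hx F hF, hy F hF], hxyW F hF⟩) _
  have hcol := card_collisions_le h𝓕 hc hW hα hsv
  have hcount := card_mul_card_add_card_le h𝓕 hc (by omega) hsv
  rw [← hn] at hcol hcount
  have card_𝓖 : #𝓗 + #𝓖 = #𝓕 := card_sdiff_add_card_eq_card hc.subset_family
  have card_𝓗₁ : #(𝓗 \ 𝓗₁) + #𝓗₁ = #𝓗 := card_sdiff_add_card_eq_card (filter_subset _ _)
  have card_𝓜 : #𝓜 ≤ (1 + 2 ^ K) * n ^ (e + 1) := by
    have h₁ : #𝓜 + #𝓖 = n.choose (e + 2) := by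
      rw [← card_image_of_injOn hc.injOn, card_sdiff_add_card_eq_card, card_powersetCard, card_univ]
      intro D hD
      obtain ⟨G, hG, rfl⟩ := mem_image.1 hD
      exact mem_powersetCard.2 ⟨subset_univ _, hc.card_eq G hG⟩
    have h₂ : n.choose (e + 2) = (n - 1).choose (e + 1) + (n - 1).choose (e + 2) := by
      obtain ⟨m, hm⟩ : ∃ m, n = m + 1 := ⟨n - 1, by omega⟩
      rw [hm, Nat.choose_succ_succ', Nat.add_sub_cancel]
    have h₃ : (n - 1).choose (e + 1) ≤ n ^ (e + 1) :=
      (Nat.choose_le_pow _ _).trans (Nat.pow_le_pow_left (by omega) _)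
    linarith
  have hexp : n * #𝓗₁ = (n - (e + 3)) * #𝓗₁ + (e + 3) * #𝓗₁ := by
    rw [← add_mul, Nat.sub_add_cancel (by omega)]
  set L := crossingBound e K with hL
  have key : n * #𝓕 ≤ n * (n - 1).choose (e + 2) + (e + 3) * #𝓗₁ +
      #𝓜 * ((e + 2) * 2 ^ K + L * ((e + 2) * (e + 2))) + n * #(𝓗 \ 𝓗₁) := by
    rw [← card_𝓖, ← card_𝓗₁]
    linarith
  have hb₁ : (e + 3) * #𝓗₁ ≤ (e + 3) * (n ^ (e + 1) * 2 ^ K) :=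
    Nat.mul_le_mul_left _ (by omega)
  have hb₂ := Nat.mul_le_mul_right ((e + 2) * 2 ^ K + L * ((e + 2) * (e + 2))) card_𝓜
  have hb₃ := Nat.mul_le_mul_left n card_𝓗₀
  refine Nat.le_of_mul_le_mul_left (c := n) ?_ (by omega)
  refine key.trans ?_
  simp only [upperConstant, ← hK, ← hL]
  calc _ ≤ n * (n - 1).choose (e + 2) + (e + 3) * (n ^ (e + 1) * 2 ^ K) +
        (1 + 2 ^ K) * n ^ (e + 1) * ((e + 2) * 2 ^ K + L * ((e + 2) * (e + 2))) +
        n * (n ^ e * 2 ^ K) := by gcongr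
    _ = _ := by ring

end upper_bound

section vc_dimension

variable {n d : ℕ} {𝓕 : Finset (Finset (Fin n))}

lemma VCDimLE.exists_certificate (h𝓕 : ∀ F ∈ 𝓕, #F = d + 1) (h : VCDimLE 𝓕 d) {F : Finset (Fin n)}
    (hF : F ∈ 𝓕) : ∃ T ⊆ F, ∀ G ∈ 𝓕, G ∩ F ≠ T := by
  by_contra! hsh
  have := h F hsh
  rw [h𝓕 F hF] at this
  omega

lemma vcDimLE_of_exists_certificate (h𝓕 : ∀ F ∈ 𝓕, #F = d + 1)
    (h : ∀ F ∈ 𝓕, ∃ T ⊆ F, ∀ G ∈ 𝓕, G ∩ F ≠ T) : VCDimLE 𝓕 d := by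
  intro S hS
  by_contra! hd
  obtain ⟨F, hF, hFS⟩ := hS S Subset.rfl
  obtain rfl : S = F := eq_of_subset_of_card_le (hFS ▸ inter_subset_left) (by rw [h𝓕 F hF]; omega)
  obtain ⟨T, hTS, hT⟩ := h S hF
  obtain ⟨G, hG, hGT⟩ := hS T hTS
  exact hT G hG hGT

end vc_dimension

theorem stmt0 (d : ℕ) (hd : 2 ≤ d) :
    ∃ C : ℕ, ∀ n : ℕ, 2 * (d + 1) ≤ n →
      ∀ 𝓕 : Finset (Finset (Fin n)),
        (∀ F ∈ 𝓕, F.card = d + 1) → VCDimLE 𝓕 d →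
        (∀ 𝓖 : Finset (Finset (Fin n)), (∀ F ∈ 𝓖, F.card = d + 1) → VCDimLE 𝓖 d →
          𝓖.card ≤ 𝓕.card) →
        (n - 1).choose d + (n - 4).choose (d - 2) ≤ 𝓕.card ∧
          𝓕.card ≤ (n - 1).choose d + C * n ^ (d - 2) := by
  obtain ⟨e, rfl⟩ : ∃ e, d = e + 2 := ⟨d - 2, by omega⟩
  refine ⟨upperConstant e, fun n hn 𝓕 h𝓕 hVC hmax ↦ ?_⟩
  have hlow : (n - 1).choose (e + 2) + (n - 4).choose (e + 2 - 2) ≤ #𝓕 := by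
    have hcard : ∀ F ∈ ahlswedeKhachatrian (e + 2) (⟨0, by omega⟩ : Fin n) ⟨1, by omega⟩
        ⟨2, by omega⟩ ⟨3, by omega⟩, #F = e + 2 + 1 :=
      fun F hF ↦ (mem_ahlswedeKhachatrian.1 hF).1
    refine le_trans ?_ (hmax _ hcard (vcDimLE_of_exists_certificate hcard fun F hF ↦
      exists_certificate_ahlswedeKhachatrian (by simp) (by simp) (by simp) hF))
    simpa only [Fintype.card_fin] using le_card_ahlswedeKhachatrian (α := Fin n) hd (by simp)
      (by simp) (by simp) (by simp) (by simp) (by simp)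
  refine ⟨hlow, ?_⟩
  simpa only [Fintype.card_fin, Nat.add_sub_cancel] using card_le_choose_add (α := Fin n) h𝓕
    (fun F hF ↦ hVC.exists_certificate h𝓕 hF) (by rw [Fintype.card_fin]; exact hn)
    (by rw [Fintype.card_fin]; omega)
end

section
/- Let n and d be positive integers, let 𝓕 ⊆ binom([n], d+1) be a family with VC-dimension at most d, and let c be an assignment of maximum 𝓕-certificates of the sets in 𝓕. Then for every set T ⊆ [n] with |T| ≤ d, the number of F ∈ 𝓕 with c(F) = T is strictly less than (d+1)!·(d+1)^{d+1}. -/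
open Finset

/-- Among the members of `𝓕` whose maximum certificate is `T`, those containing a given `S ⊇ T`
with `S.card ≤ d` are all hit, outside `S`, by a set of at most `d + 1` elements. -/
theorem exists_hitting_set {n d : ℕ} {𝓕 : Finset (Finset (Fin n))}
    (h𝓕 : ∀ F ∈ 𝓕, F.card = d + 1) {c : Finset (Fin n) → Finset (Fin n)}
    (hc : IsMaxCertAssignment 𝓕 c) {S T : Finset (Fin n)} (hTS : T ⊆ S) (hS : S.card ≤ d) :
    ∃ H : Finset (Fin n), H.card ≤ d + 1 ∧ Disjoint H S ∧
      ∀ F ∈ 𝓕, c F = T → S ⊆ F → ∃ x ∈ H, x ∈ F := by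
  by_cases hne : ∃ F ∈ 𝓕, c F = T ∧ S ⊆ F
  swap
  · exact ⟨∅, by simp, by simp, fun F hF hcF hSF => (hne ⟨F, hF, hcF, hSF⟩).elim⟩
  obtain ⟨F₁, hF₁, hcF₁, hSF₁⟩ := hne
  -- It suffices to find a member of `𝓕` whose trace on `S` is `T`.
  obtain ⟨F', hF', hinter⟩ : ∃ F' ∈ 𝓕, F' ∩ S = T := by
    rcases eq_or_ne S T with rfl | hST
    · exact ⟨F₁, hF₁, inter_eq_right.2 hSF₁⟩
    · obtain ⟨x, hxF, hxS⟩ : ∃ x ∈ F₁, x ∉ S :=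
        exists_mem_notMem_of_card_lt_card (by rw [h𝓕 F₁ hF₁]; omega)
      obtain ⟨y, hyS, hyT⟩ : ∃ y ∈ S, y ∉ T :=
        Finset.not_subset.1 fun h => hST (h.antisymm hTS)
      have hproper : insert x T ⊂ F₁ := by
        refine (ssubset_iff_of_subset
          (insert_subset hxF (hTS.trans hSF₁))).2 ⟨y, hSF₁ hyS, ?_⟩
        simp only [mem_insert, not_or]
        exact ⟨fun h => hxS (h ▸ hyS), hyT⟩
      have hnot : ¬ IsCert 𝓕 F₁ (insert x T) := fun h => by
        have hle := (hc F₁ hF₁).2 _ h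
        rw [hcF₁, card_insert_of_notMem fun h => hxS (hTS h)] at hle
        omega
      obtain ⟨F', hF', htrace⟩ : ∃ F' ∈ 𝓕, F' ∩ F₁ = insert x T := by
        by_contra! h
        exact hnot ⟨hproper, h⟩
      refine ⟨F', hF', ?_⟩
      calc F' ∩ S = F' ∩ F₁ ∩ S := by rw [inter_assoc, inter_eq_right.2 hSF₁]
        _ = T := by rw [htrace, insert_inter_of_notMem hxS, inter_eq_left.2 hTS]
  refine ⟨F' \ S, (card_le_card sdiff_subset).trans (h𝓕 F' hF').le, sdiff_disjoint, ?_⟩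
  intro F hF hcF hSF
  by_contra! h
  have hne : F' ∩ F ≠ T := hcF ▸ (hc F hF).1.2 F' hF'
  refine hne (subset_antisymm ?_ ?_)
  · intro x hx
    rw [mem_inter] at hx
    rw [← hinter, mem_inter]
    exact ⟨hx.1, by_contra fun hxS => h x (mem_sdiff.2 ⟨hx.1, hxS⟩) hx.2⟩
  · exact subset_inter (hinter ▸ inter_subset_left) (hTS.trans hSF)

/-- At most `(d + 1) ^ (d + 1 - S.card)` members of `𝓕` with maximum certificate `T` contain a
given `S ⊇ T`. -/
theorem card_filter_maxCert_superset_le {n d : ℕ} {𝓕 : Finset (Finset (Fin n))}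
    (h𝓕 : ∀ F ∈ 𝓕, F.card = d + 1) {c : Finset (Fin n) → Finset (Fin n)}
    (hc : IsMaxCertAssignment 𝓕 c) {T : Finset (Fin n)} (m : ℕ) :
    ∀ S : Finset (Fin n), T ⊆ S → S.card + m = d + 1 →
      (𝓕.filter (fun F => c F = T ∧ S ⊆ F)).card ≤ (d + 1) ^ m := by
  induction m with
  | zero =>
    intro S _ hS
    have hsub : 𝓕.filter (fun F => c F = T ∧ S ⊆ F) ⊆ {S} := by
      intro F hF
      rw [mem_filter] at hF
      rw [mem_singleton]
      exact (eq_of_subset_of_card_le hF.2.2 (by rw [h𝓕 F hF.1]; omega)).symm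
    simpa using card_le_card hsub
  | succ m ih =>
    intro S hTS hS
    obtain ⟨H, hH, hdisj, hhit⟩ :=
      exists_hitting_set h𝓕 hc hTS (show S.card ≤ d by omega)
    have hsub : 𝓕.filter (fun F => c F = T ∧ S ⊆ F) ⊆
        H.biUnion fun x => 𝓕.filter (fun F => c F = T ∧ insert x S ⊆ F) := by
      intro F hF
      rw [mem_filter] at hF
      obtain ⟨hF, hcF, hSF⟩ := hF
      obtain ⟨x, hxH, hxF⟩ := hhit F hF hcF hSF
      exact mem_biUnion.2 ⟨x, hxH, mem_filter.2 ⟨hF, hcF, insert_subset hxF hSF⟩⟩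
    calc _ ≤ _ := card_le_card hsub
      _ ≤ H.card * (d + 1) ^ m := card_biUnion_le_card_mul _ _ _ fun x hx =>
          ih _ (hTS.trans (subset_insert x S)) (by
            rw [card_insert_of_notMem (disjoint_left.1 hdisj hx)]; omega)
      _ ≤ (d + 1) * (d + 1) ^ m := Nat.mul_le_mul_right _ hH
      _ = (d + 1) ^ (m + 1) := (pow_succ' _ _).symm

theorem stmt2 (n d : ℕ) (hn : 1 ≤ n) (hd : 1 ≤ d)
    (𝓕 : Finset (Finset (Fin n))) (h𝓕 : ∀ F ∈ 𝓕, F.card = d + 1)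
    (hVC : VCDimLE 𝓕 d) (c : Finset (Fin n) → Finset (Fin n))
    (hc : IsMaxCertAssignment 𝓕 c) (T : Finset (Fin n)) (hT : T.card ≤ d) :
    (𝓕.filter (fun F => c F = T)).card < Nat.factorial (d + 1) * (d + 1) ^ (d + 1) := by
  have hsub : 𝓕.filter (fun F => c F = T) ⊆ 𝓕.filter (fun F => c F = T ∧ T ⊆ F) := by
    intro F hF
    rw [mem_filter] at hF ⊢
    exact ⟨hF.1, hF.2, hF.2 ▸ (hc F hF.1).1.1.subset⟩
  calc _ ≤ _ := card_le_card hsub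
    _ ≤ (d + 1) ^ (d + 1 - T.card) :=
        card_filter_maxCert_superset_le h𝓕 hc _ T subset_rfl (by omega)
    _ ≤ (d + 1) ^ (d + 1) := Nat.pow_le_pow_right (by omega) (by omega)
    _ < _ := lt_mul_of_one_lt_left (by positivity) (Nat.one_lt_factorial.2 (by omega))
end

section
/- For every positive integer d there exists a constant C depending only on d such that the following holds. Let n be a positive integer, let 𝓕 ⊆ binom([n], d+1) be a family with VC-dimension at most d, and let c be an assignment of maximum 𝓕-certificates of the sets in 𝓕. Then the number of F ∈ 𝓕 with |c(F)| ≤ d−2 is at most C·n^{d−2}. -/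
open Finset

/-- In a hypergraph with edges of size at most `k`, at most `k ^ m` minimal transversals extend a
given set by at most `m` elements. -/
theorem card_minimal_transversals_le {α : Type*} [DecidableEq α] {H : Finset (Finset α)} {k : ℕ}
    (hk : 1 ≤ k) (hH : ∀ E ∈ H, E.card ≤ k) (m : ℕ) (S : Finset α) (B : Finset (Finset α))
    (hSB : ∀ F ∈ B, S ⊆ F) (hcard : ∀ F ∈ B, F.card ≤ S.card + m)
    (hhit : ∀ F ∈ B, ∀ E ∈ H, (E ∩ F).Nonempty)
    (hmin : ∀ F ∈ B, ∀ x ∈ F, x ∉ S → ∃ E ∈ H, E ∩ F ⊆ {x}) :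
    B.card ≤ k ^ m := by
  induction m generalizing S B with
  | zero =>
    rw [pow_zero, Finset.card_le_one]
    intro F hF G hG
    rw [← Finset.eq_of_subset_of_card_le (hSB F hF) (hcard F hF),
      ← Finset.eq_of_subset_of_card_le (hSB G hG) (hcard G hG)]
  | succ m ih =>
    by_cases hS : ∀ E ∈ H, (E ∩ S).Nonempty
    · have hB : ∀ F ∈ B, F = S := fun F hF => by
        refine Finset.Subset.antisymm (fun x hx => ?_) (hSB F hF)
        by_contra hxS
        obtain ⟨E, hE, hEF⟩ := hmin F hF x hx hxS
        obtain ⟨y, hy⟩ := hS E hE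
        rw [Finset.mem_inter] at hy
        have hyx := hEF (Finset.mem_inter.2 ⟨hy.1, hSB F hF hy.2⟩)
        rw [Finset.mem_singleton] at hyx
        exact hxS (hyx ▸ hy.2)
      refine le_trans (Finset.card_le_one.2 fun F hF G hG => ?_) (Nat.one_le_pow _ _ hk)
      rw [hB F hF, hB G hG]
    · push Not at hS
      obtain ⟨E, hE, hES⟩ := hS
      have hcover : B ⊆ E.biUnion fun e => B.filter fun F => e ∈ F := fun F hF => by
        obtain ⟨e, he⟩ := hhit F hF E hE
        rw [Finset.mem_inter] at he
        exact Finset.mem_biUnion.2 ⟨e, he.1, Finset.mem_filter.2 ⟨hF, he.2⟩⟩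
      have hbranch : ∀ e ∈ E, (B.filter fun F => e ∈ F).card ≤ k ^ m := fun e he => by
        have heS : e ∉ S := fun h => by
          have := Finset.mem_inter.2 ⟨he, h⟩
          simp [hES] at this
        refine ih (insert e S) _ (fun F hF => ?_) (fun F hF => ?_) (fun F hF => ?_)
          (fun F hF x hx hxS => ?_) <;> rw [Finset.mem_filter] at hF
        · exact Finset.insert_subset hF.2 (hSB F hF.1)
        · have := hcard F hF.1
          rw [Finset.card_insert_of_notMem heS]
          omega
        · exact hhit F hF.1
        · exact hmin F hF.1 x hx fun h => hxS (Finset.mem_insert_of_mem h)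
      calc B.card ≤ _ := Finset.card_le_card hcover
        _ ≤ E.card * k ^ m := Finset.card_biUnion_le_card_mul _ _ _ hbranch
        _ ≤ k * k ^ m := Nat.mul_le_mul_right _ (hH E hE)
        _ = k ^ (m + 1) := (pow_succ' k m).symm

/-- There are at most `(m + 1) * n ^ m` subsets of an `n`-set with at most `m` elements. -/
theorem card_filter_card_le_le {n : ℕ} (hn : 1 ≤ n) (m : ℕ) :
    (Finset.univ.filter fun T : Finset (Fin n) => T.card ≤ m).card ≤ (m + 1) * n ^ m := by
  have hcover : (Finset.univ.filter fun T : Finset (Fin n) => T.card ≤ m) ⊆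
      (Finset.range (m + 1)).biUnion fun t => Finset.powersetCard t Finset.univ := fun T hT => by
    simpa [Nat.lt_succ_iff] using hT
  refine (Finset.card_le_card hcover).trans ?_
  refine (Finset.card_biUnion_le_card_mul _ _ (n ^ m) fun t ht => ?_).trans
    (by rw [Finset.card_range])
  rw [Finset.card_powersetCard, Finset.card_univ, Fintype.card_fin]
  exact (Nat.choose_le_pow n t).trans
    (Nat.pow_le_pow_right hn (Nat.lt_succ_iff.1 (Finset.mem_range.1 ht)))

/-- A set of size less than `d` is the maximum certificate of boundedly many members of a
`(d + 1)`-uniform family. -/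
theorem card_filter_maxCert_eq_le {n d : ℕ} {𝓕 : Finset (Finset (Fin n))}
    (hF : ∀ F ∈ 𝓕, F.card = d + 1) {c : Finset (Fin n) → Finset (Fin n)}
    (hc : IsMaxCertAssignment 𝓕 c) {T : Finset (Fin n)} (hT : T.card < d) :
    (𝓕.filter fun F => c F = T).card ≤ (d + 1) ^ (d + 1) := by
  refine card_minimal_transversals_le (H := (𝓕.filter fun F => T ⊆ F).image fun F => F \ T)
    (by omega) (fun E hE => ?_) (d + 1) T _ (fun F h => ?_) (fun F h => ?_) (fun F h E hE => ?_)
    (fun F h x hx hxT => ?_)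
  · obtain ⟨G, hG, rfl⟩ := Finset.mem_image.1 hE
    rw [← hF G (Finset.mem_filter.1 hG).1]
    exact Finset.card_le_card Finset.sdiff_subset
  all_goals
    obtain ⟨hF𝓕, rfl⟩ := Finset.mem_filter.1 h
    obtain ⟨⟨hsub, hcert⟩, hmax⟩ := hc F hF𝓕
  · exact hsub.1
  · rw [hF F hF𝓕]
    omega
  · obtain ⟨G, hG, rfl⟩ := Finset.mem_image.1 hE
    rw [Finset.mem_filter] at hG
    by_contra hempty
    refine hcert G hG.1 (Finset.Subset.antisymm (fun y hy => ?_)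
      (Finset.subset_inter hG.2 hsub.1))
    rw [Finset.mem_inter] at hy
    by_contra hyT
    exact hempty ⟨y, by simp [hy.1, hy.2, hyT]⟩
  · have hcard : (insert x (c F)).card = (c F).card + 1 := Finset.card_insert_of_notMem hxT
    have hss : insert x (c F) ⊂ F := by
      refine (Finset.insert_subset hx hsub.1).ssubset_of_ne fun heq => ?_
      have := hF F hF𝓕
      rw [← heq, hcard] at this
      omega
    have hnot : ¬ IsCert 𝓕 F (insert x (c F)) := fun hcert' => by
      have := hmax _ hcert'
      omega
    obtain ⟨G, hG, hGF⟩ : ∃ G ∈ 𝓕, G ∩ F = insert x (c F) := by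
      by_contra! hall
      exact hnot ⟨hss, hall⟩
    have hcG : c F ⊆ G :=
      (Finset.subset_insert x (c F)).trans (hGF ▸ Finset.inter_subset_left)
    refine ⟨G \ c F, Finset.mem_image_of_mem _ (Finset.mem_filter.2 ⟨hG, hcG⟩), fun y hy => ?_⟩
    simp only [Finset.mem_inter, Finset.mem_sdiff] at hy
    have hy' : y ∈ insert x (c F) := hGF ▸ Finset.mem_inter.2 ⟨hy.1.1, hy.2⟩
    rw [Finset.mem_singleton]
    exact (Finset.mem_insert.1 hy').resolve_right hy.1.2

theorem stmt3 (d : ℕ) (hd : 1 ≤ d) :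
    ∃ C : ℕ, ∀ n : ℕ, 1 ≤ n → ∀ 𝓕 : Finset (Finset (Fin n)),
      (∀ F ∈ 𝓕, F.card = d + 1) → VCDimLE 𝓕 d →
      ∀ c : Finset (Fin n) → Finset (Fin n), IsMaxCertAssignment 𝓕 c →
        (𝓕.filter (fun F => (c F).card ≤ d - 2)).card ≤ C * n ^ (d - 2) := by
  refine ⟨(d + 1) ^ (d + 1) * (d - 2 + 1), fun n hn 𝓕 hF _ c hc => ?_⟩
  have hfiber := Finset.card_le_mul_card_image_of_maps_to (f := c)
    (s := 𝓕.filter fun F => (c F).card ≤ d - 2)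
    (t := Finset.univ.filter fun T : Finset (Fin n) => T.card ≤ d - 2)
    (fun F h => by simpa using (Finset.mem_filter.1 h).2) ((d + 1) ^ (d + 1)) fun T hT =>
      (Finset.card_le_card (Finset.filter_subset_filter _ (Finset.filter_subset _ _))).trans
        (card_filter_maxCert_eq_le hF hc (by
          have := (Finset.mem_filter.1 hT).2
          omega))
  refine hfiber.trans ?_
  rw [mul_assoc]
  exact Nat.mul_le_mul_left _ (card_filter_card_le_le hn (d - 2))
end

section
/- Let n and d be positive integers, let 𝓕 ⊆ binom([n], d+1) be a family with VC-dimension at most d, and let c be an assignment of maximum 𝓕-certificates of the sets in 𝓕. Suppose T = c(F₀) for some F₀ ∈ 𝓕 and |T| = d−1. Then one of the following holds: (i) there exist distinct elements x, y, z ∈ [n] \ T such that c⁻¹(T) = {F ∈ 𝓕 : T ⊆ F} = {Txy, Tyz, Tzx}; (ii) there exist distinct elements x, y, z ∈ [n] \ T such that c⁻¹(T) = {Txy, Txz}, and there exists U ⊆ [n] \ (T ∪ {x,y,z}) such that {F ∈ 𝓕 : T ⊆ F} = {Txy, Txz} ∪ {Txu : u ∈ U} or {F ∈ 𝓕 : T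 ⊆ F} = {Txy, Txz, Tyz} ∪ {Txu : u ∈ U}; (iii) there exist distinct elements x, y ∈ [n] \ T such that c⁻¹(T) = {Txy}, and there exist U, V ⊆ [n] \ (T ∪ {x,y}) such that {F ∈ 𝓕 : T ⊆ F} = {Txy} ∪ {Txu : u ∈ U} ∪ {Tyv : v ∈ V}. -/
open Finset

/-- A superset `F` of `T` with two more elements is determined by any two distinct elements of
`F` outside `T`. -/
lemma eq_union_pair {α : Type*} [DecidableEq α] {T F : Finset α} {x y : α}
    (hF : F.card = T.card + 2) (hTF : T ⊆ F) (hxy : x ≠ y) (hx : x ∉ T) (hy : y ∉ T)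
    (hxF : x ∈ F) (hyF : y ∈ F) : F = T ∪ {x, y} := by
  refine (eq_of_subset_of_card_le (by grind) ?_).symm
  rw [card_union_of_disjoint (by simp [hx, hy]), card_pair hxy, hF]

lemma exists_eq_union_pair_of_mem {α : Type*} [DecidableEq α] {T F : Finset α} {x : α}
    (hF : F.card = T.card + 2) (hTF : T ⊆ F) (hx : x ∉ T) (hxF : x ∈ F) :
    ∃ u, u ∉ T ∧ u ≠ x ∧ F = T ∪ {x, u} := by
  obtain ⟨u, hu, hu'⟩ : ∃ u ∈ F, u ∉ insert x T := by
    apply exists_mem_notMem_of_card_lt_card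
    rw [card_insert_of_notMem hx]
    omega
  simp only [mem_insert, not_or] at hu'
  exact ⟨u, hu'.2, hu'.1, eq_union_pair hF hTF (Ne.symm hu'.1) hx hu'.2 hxF hu⟩

lemma exists_eq_union_pair {α : Type*} [DecidableEq α] {T F : Finset α}
    (hF : F.card = T.card + 2) (hTF : T ⊆ F) :
    ∃ x y, x ≠ y ∧ x ∉ T ∧ y ∉ T ∧ F = T ∪ {x, y} := by
  obtain ⟨x, hxF, hx⟩ : ∃ x ∈ F, x ∉ T := exists_mem_notMem_of_card_lt_card (by omega)
  obtain ⟨y, hy, hyx, h⟩ := exists_eq_union_pair_of_mem hF hTF hx hxF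
  exact ⟨x, y, hyx.symm, hx, hy, h⟩

lemma IsCert.mem_or_mem {n : ℕ} {𝓖 : Finset (Finset (Fin n))} {T G : Finset (Fin n)}
    {x y : Fin n} (h : IsCert 𝓖 (T ∪ {x, y}) T) (hG : G ∈ 𝓖) (hTG : T ⊆ G) :
    x ∈ G ∨ y ∈ G := by
  by_contra! hxy
  apply h.2 G hG
  grind

/-- If `T` is a maximum certificate of `T ∪ {x, y}`, then `T ∪ {x}` is no certificate, so some
member of the family contains `T ∪ {x}` and avoids `y`. -/
lemma IsMaxCertAssignment.exists_mem_notMem {n : ℕ} {𝓖 : Finset (Finset (Fin n))}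
    {c : Finset (Fin n) → Finset (Fin n)} (hc : IsMaxCertAssignment 𝓖 c)
    {T : Finset (Fin n)} {x y : Fin n} (hxy : x ≠ y) (hx : x ∉ T) (hy : y ∉ T)
    (hF : T ∪ {x, y} ∈ 𝓖) (hcF : c (T ∪ {x, y}) = T) :
    ∃ G ∈ 𝓖, T ⊆ G ∧ x ∈ G ∧ y ∉ G := by
  by_contra! h
  have hcert : IsCert 𝓖 (T ∪ {x, y}) (insert x T) := by
    refine ⟨(ssubset_iff_of_subset (by grind)).2 ⟨y, by grind⟩, fun G hG hGx => ?_⟩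
    have hsub : insert x T ⊆ G := hGx ▸ inter_subset_left
    have hyG := h G hG (by grind) (by grind)
    have hyx : y ∈ insert x T := hGx ▸ (by simp [hyG])
    grind
  have hle := (hc _ hF).2 _ hcert
  rw [hcF, card_insert_of_notMem hx] at hle
  omega

theorem stmt5 (n d : ℕ) (hn : 1 ≤ n) (hd : 1 ≤ d)
    (𝓕 : Finset (Finset (Fin n))) (h𝓕 : ∀ F ∈ 𝓕, F.card = d + 1)
    (hVC : VCDimLE 𝓕 d) (c : Finset (Fin n) → Finset (Fin n))
    (hc : IsMaxCertAssignment 𝓕 c) (F₀ : Finset (Fin n)) (hF₀ : F₀ ∈ 𝓕)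
    (T : Finset (Fin n)) (hT : c F₀ = T) (hTcard : T.card = d - 1) :
    -- (i)
    (∃ x y z : Fin n, x ≠ y ∧ y ≠ z ∧ x ≠ z ∧ x ∉ T ∧ y ∉ T ∧ z ∉ T ∧
      𝓕.filter (fun F => c F = T) = 𝓕.filter (fun F => T ⊆ F) ∧
      𝓕.filter (fun F => T ⊆ F) = {T ∪ {x, y}, T ∪ {y, z}, T ∪ {z, x}}) ∨
    -- (ii)
    (∃ x y z : Fin n, x ≠ y ∧ y ≠ z ∧ x ≠ z ∧ x ∉ T ∧ y ∉ T ∧ z ∉ T ∧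
      𝓕.filter (fun F => c F = T) = {T ∪ {x, y}, T ∪ {x, z}} ∧
      ∃ U : Finset (Fin n), (∀ u ∈ U, u ∉ T ∧ u ≠ x ∧ u ≠ y ∧ u ≠ z) ∧
        (𝓕.filter (fun F => T ⊆ F) =
            {T ∪ {x, y}, T ∪ {x, z}} ∪ U.image (fun u => T ∪ {x, u}) ∨
          𝓕.filter (fun F => T ⊆ F) =
            {T ∪ {x, y}, T ∪ {x, z}, T ∪ {y, z}} ∪ U.image (fun u => T ∪ {x, u}))) ∨
    -- (iii)
    (∃ x y : Fin n, x ≠ y ∧ x ∉ T ∧ y ∉ T ∧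
      𝓕.filter (fun F => c F = T) = {T ∪ {x, y}} ∧
      ∃ U V : Finset (Fin n),
        (∀ u ∈ U, u ∉ T ∧ u ≠ x ∧ u ≠ y) ∧ (∀ v ∈ V, v ∉ T ∧ v ≠ x ∧ v ≠ y) ∧
        𝓕.filter (fun F => T ⊆ F) =
          {T ∪ {x, y}} ∪ U.image (fun u => T ∪ {x, u}) ∪ V.image (fun v => T ∪ {y, v})) := by
  have hcard : ∀ F ∈ 𝓕, F.card = T.card + 2 := fun F hF => by rw [h𝓕 F hF]; omega
  have hsub : ∀ F ∈ 𝓕, c F = T → T ⊆ F := fun F hF h => h ▸ (hc F hF).1.1.subset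
  have hcert : ∀ F ∈ 𝓕, c F = T → IsCert 𝓕 F T := fun F hF h => by
    simpa only [h] using (hc F hF).1
  obtain ⟨x, y, hxy, hx, hy, rfl⟩ := exists_eq_union_pair (hcard _ hF₀) (hsub _ hF₀ hT)
  by_cases hsingle : ∀ F ∈ 𝓕, c F = T → F = T ∪ {x, y}
  · refine Or.inr (Or.inr ⟨x, y, hxy, hx, hy, by grind,
      univ.filter (fun u => (u ∉ T ∧ u ≠ x ∧ u ≠ y) ∧ T ∪ {x, u} ∈ 𝓕),
      univ.filter (fun u => (u ∉ T ∧ u ≠ x ∧ u ≠ y) ∧ T ∪ {y, u} ∈ 𝓕), by grind, by grind, ?_⟩)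
    ext F
    simp only [mem_filter, mem_union, mem_image, mem_singleton, mem_univ, true_and]
    constructor
    · rintro ⟨hF, hTF⟩
      rcases (hcert _ hF₀ hT).mem_or_mem hF hTF with h | h
      · obtain ⟨u, hu, hux, rfl⟩ := exists_eq_union_pair_of_mem (hcard F hF) hTF hx h
        grind
      · obtain ⟨u, hu, huy, rfl⟩ := exists_eq_union_pair_of_mem (hcard F hF) hTF hy h
        grind
    · grind
  -- A second preimage of `T` shares exactly one of `x`, `y` with the first; call that one `x`.
  obtain ⟨x, y, z, hxy, hxz, hyz, hx, hy, hz, hFy, hcy, hFz, hcz⟩ :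
      ∃ x y z, x ≠ y ∧ x ≠ z ∧ y ≠ z ∧ x ∉ T ∧ y ∉ T ∧ z ∉ T ∧ T ∪ {x, y} ∈ 𝓕 ∧
        c (T ∪ {x, y}) = T ∧ T ∪ {x, z} ∈ 𝓕 ∧ c (T ∪ {x, z}) = T := by
    push Not at hsingle
    obtain ⟨F, hF, hcF, hne⟩ := hsingle
    rcases (hcert _ hF₀ hT).mem_or_mem hF (hsub F hF hcF) with h | h
    · obtain ⟨u, hu, hux, rfl⟩ := exists_eq_union_pair_of_mem (hcard F hF) (hsub F hF hcF) hx h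
      exact ⟨x, y, u, by grind⟩
    · obtain ⟨u, hu, huy, rfl⟩ := exists_eq_union_pair_of_mem (hcard F hF) (hsub F hF hcF) hy h
      rw [pair_comm] at hF₀ hT
      exact ⟨y, x, u, by grind⟩
  have key : ∀ F ∈ 𝓕, T ⊆ F →
      F = T ∪ {y, z} ∨ ∃ u, u ∉ T ∧ u ≠ x ∧ F = T ∪ {x, u} := fun F hF hTF => by
    by_cases h : x ∈ F
    · exact Or.inr (exists_eq_union_pair_of_mem (hcard F hF) hTF hx h)
    · exact Or.inl (eq_union_pair (hcard F hF) hTF hyz hy hz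
        (((hcert _ hFy hcy).mem_or_mem hF hTF).resolve_left h)
        (((hcert _ hFz hcz).mem_or_mem hF hTF).resolve_left h))
  by_cases hyz' : T ∪ {y, z} ∈ 𝓕 ∧ c (T ∪ {y, z}) = T
  · obtain ⟨hFyz, hcyz⟩ := hyz'
    have htri : ∀ F ∈ 𝓕, T ⊆ F → F = T ∪ {x, y} ∨ F = T ∪ {y, z} ∨ F = T ∪ {z, x} :=
      fun F hF hTF => by
        have hmem := (hcert _ hFyz hcyz).mem_or_mem hF hTF
        rcases key F hF hTF with h | ⟨u, hu, hux, rfl⟩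
        · exact Or.inr (Or.inl h)
        · have : u = y ∨ u = z := by grind
          rcases this with rfl | rfl
          · exact Or.inl rfl
          · exact Or.inr (Or.inr (by rw [pair_comm]))
    rw [pair_comm] at hFz hcz
    refine Or.inl ⟨x, y, z, hxy, hyz, hxz, hx, hy, hz,
      filter_congr fun F hF => ⟨hsub F hF, fun hTF => ?_⟩, ?_⟩
    · rcases htri F hF hTF with rfl | rfl | rfl <;> assumption
    · ext F
      simp only [mem_filter, mem_insert, mem_singleton]
      constructor
      · exact fun h => htri F h.1 h.2
      · rintro (rfl | rfl | rfl) <;> exact ⟨by assumption, subset_union_left⟩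
  · refine Or.inr (Or.inl ⟨x, y, z, hxy, hyz, hxz, hx, hy, hz, ?_,
      univ.filter (fun u => (u ∉ T ∧ u ≠ x ∧ u ≠ y ∧ u ≠ z) ∧ T ∪ {x, u} ∈ 𝓕), by grind, ?_⟩)
    · ext F
      simp only [mem_filter, mem_insert, mem_singleton]
      constructor
      · rintro ⟨hF, hcF⟩
        rcases key F hF (hsub F hF hcF) with rfl | ⟨u, hu, hux, rfl⟩
        · exact absurd ⟨hF, hcF⟩ hyz'
        by_contra! hne
        have huy : u ≠ y := by rintro rfl; exact hne.1 rfl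
        have huz : u ≠ z := by rintro rfl; exact hne.2 rfl
        -- Some member contains `T ∪ {y}` and avoids `x`, hence contains `z` and `u` as well.
        obtain ⟨G, hG, hTG, hyG, hxG⟩ := hc.exists_mem_notMem hxy.symm hy hx
          (by rwa [pair_comm]) (by rwa [pair_comm])
        have huG := ((hcert _ hF hcF).mem_or_mem hG hTG).resolve_left hxG
        rcases key G hG hTG with rfl | ⟨v, -, -, rfl⟩
        · grind
        · grind
      · rintro (rfl | rfl)
        · exact ⟨hFy, hcy⟩
        · exact ⟨hFz, hcz⟩
    · by_cases hFyz : T ∪ {y, z} ∈ 𝓕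
      · right
        ext F
        simp only [mem_filter, mem_union, mem_image, mem_insert, mem_singleton, mem_univ, true_and]
        constructor
        · rintro ⟨hF, hTF⟩
          rcases key F hF hTF with rfl | ⟨u, hu, hux, rfl⟩ <;> grind
        · grind
      · left
        ext F
        simp only [mem_filter, mem_union, mem_image, mem_insert, mem_singleton, mem_univ, true_and]
        constructor
        · rintro ⟨hF, hTF⟩
          rcases key F hF hTF with rfl | ⟨u, hu, hux, rfl⟩ <;> grind
        · grind
end

section
/- Let n and d be positive integers, let 𝓕 ⊆ binom([n], d+1) be a family with VC-dimension at most d, and let c be an assignment of maximum 𝓕-certificates of the sets in 𝓕. Let 𝓟 = {F_1, F_1′, …, F_k, F_k′} be a collection of 2k pairwise distinct sets such that for each i ∈ [k], F_i, F_i′ ∈ 𝓕, |c(F_i)| = |c(F_i′)| = d−1, and c(F_i) ∪ c(F_i′) = F_i ∩ F_i′. Then |𝓟| ≤ 0.1·|∂̄𝓕| + 400·d²·n^{d−2}, where ∂̄𝓕 = binom([n], d) \ ∂𝓕. -/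
open Finset

section Certificates

variable {n : ℕ} {𝓕 : Finset (Finset (Fin n))} {c : Finset (Fin n) → Finset (Fin n)}

lemma IsCert.exists_mem_inter_sdiff {F T G : Finset (Fin n)} (h : IsCert 𝓕 F T) (hG : G ∈ 𝓕)
    (hTG : T ⊆ G) : ∃ z ∈ G, z ∈ F ∧ z ∉ T := by
  by_contra! hcon
  refine h.2 G hG (Subset.antisymm (fun z hz => ?_) (subset_inter hTG h.1.1))
  rw [mem_inter] at hz
  exact hcon z hz.1 hz.2

lemma eq_insert_insert {C F : Finset (Fin n)} {p q : Fin n} (hCF : C ⊆ F)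
    (hcard : F.card = C.card + 2) (hp : p ∈ F) (hpC : p ∉ C) (hq : q ∈ F) (hqC : q ∉ C)
    (hpq : p ≠ q) : F = insert p (insert q C) := by
  refine (eq_of_subset_of_card_le ?_ ?_).symm
  · simp [insert_subset_iff, hp, hq, hCF]
  · rw [card_insert_of_notMem (by simp [hpq, hpC]), card_insert_of_notMem hqC, hcard]

lemma IsMaxCertAssignment.exists_eq_insert_insert {d : ℕ} (h𝓕 : ∀ F ∈ 𝓕, F.card = d + 1)
    (hc : IsMaxCertAssignment 𝓕 c) {F : Finset (Fin n)} (hF : F ∈ 𝓕)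
    (hcard : (c F).card + 1 = d) {a : Fin n} (ha : a ∈ F) (hac : a ∉ c F) :
    ∃ y, y ∉ F ∧ insert y (insert a (c F)) ∈ 𝓕 := by
  have hcF := (hc F hF).1.1.1
  have hins : (insert a (c F)).card = d := by rw [card_insert_of_notMem hac, hcard]
  have hsub : insert a (c F) ⊆ F := insert_subset ha hcF
  have hss : insert a (c F) ⊂ F := by
    refine ⟨hsub, fun h => ?_⟩
    have := card_le_card h
    have := h𝓕 F hF
    omega
  have hnot : ¬ IsCert 𝓕 F (insert a (c F)) := fun h => by
    have := (hc F hF).2 _ h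
    omega
  have : ∃ G ∈ 𝓕, G ∩ F = insert a (c F) := by
    by_contra! hcon
    exact hnot ⟨hss, hcon⟩
  obtain ⟨G, hG, hGF⟩ := this
  have hsubG : insert a (c F) ⊆ G := hGF ▸ inter_subset_left
  have hGc := h𝓕 G hG
  obtain ⟨y, hyG, hy⟩ : ∃ y ∈ G, y ∉ insert a (c F) := by
    by_contra! hcon
    have := card_le_card (show G ⊆ insert a (c F) from hcon)
    omega
  refine ⟨y, fun hyF => hy (hGF ▸ mem_inter.2 ⟨hyG, hyF⟩), ?_⟩
  convert hG using 1
  refine eq_of_subset_of_card_le (insert_subset hyG hsubG) ?_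
  rw [card_insert_of_notMem hy]
  omega

/-- The same set of size `d - 1` is the chosen maximum certificate of at most three members. -/
lemma IsMaxCertAssignment.card_filter_eq_le_three {d : ℕ} (h𝓕 : ∀ F ∈ 𝓕, F.card = d + 1)
    (hc : IsMaxCertAssignment 𝓕 c) {C : Finset (Fin n)} (hC : C.card + 1 = d) :
    (𝓕.filter (fun F => c F = C)).card ≤ 3 := by
  rcases (𝓕.filter (fun F => c F = C)).eq_empty_or_nonempty with h | ⟨F, hF⟩
  · simp [h]
  rw [mem_filter] at hF
  obtain ⟨hF, rfl⟩ := hF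
  have hcF := (hc F hF).1.1.1
  have htwo : (F \ c F).card = 2 := by
    rw [card_sdiff_of_subset hcF, h𝓕 F hF]
    omega
  obtain ⟨a, v, hav, hFe⟩ := card_eq_two.1 htwo
  have ha : a ∈ F \ c F := by simp [hFe]
  have hv : v ∈ F \ c F := by simp [hFe]
  rw [mem_sdiff] at ha hv
  obtain ⟨y, hyF, hy⟩ := hc.exists_eq_insert_insert h𝓕 hF hC ha.1 ha.2
  obtain ⟨z, hzF, hz⟩ := hc.exists_eq_insert_insert h𝓕 hF hC hv.1 hv.2
  have hsub : 𝓕.filter (fun F' => c F' = c F) ⊆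
      {insert a (insert v (c F)), insert a (insert z (c F)), insert y (insert v (c F))} := by
    intro F' hF'
    rw [mem_filter] at hF'
    obtain ⟨hF', hcc⟩ := hF'
    have hcert : IsCert 𝓕 F' (c F) := hcc ▸ (hc F' hF').1
    have hcard : F'.card = (c F).card + 2 := by
      rw [h𝓕 F' hF']
      omega
    have hcF' := hcert.1.1
    have hyc : y ∉ c F := fun h => hyF (hcF h)
    have hzc : z ∉ c F := fun h => hzF (hcF h)
    have haz : a ≠ z := fun h => hzF (h ▸ ha.1)
    have hyv : y ≠ v := fun h => hyF (h ▸ hv.1)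
    have h1 : a ∈ F' ∨ v ∈ F' := by
      obtain ⟨w, hwF, hwF', hwc⟩ := hcert.exists_mem_inter_sdiff hF hcF
      have hw : w ∈ F \ c F := mem_sdiff.2 ⟨hwF, hwc⟩
      rw [hFe, mem_insert, mem_singleton] at hw
      rcases hw with rfl | rfl <;> simp [hwF']
    have h2 : y ∈ F' ∨ a ∈ F' := by
      obtain ⟨w, hwF, hwF', hwc⟩ := hcert.exists_mem_inter_sdiff hy
        ((subset_insert _ _).trans (subset_insert _ _))
      simp only [mem_insert, hwc, or_false] at hwF
      rcases hwF with rfl | rfl <;> simp [hwF']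
    have h3 : z ∈ F' ∨ v ∈ F' := by
      obtain ⟨w, hwF, hwF', hwc⟩ := hcert.exists_mem_inter_sdiff hz
        ((subset_insert _ _).trans (subset_insert _ _))
      simp only [mem_insert, hwc, or_false] at hwF
      rcases hwF with rfl | rfl <;> simp [hwF']
    rw [mem_insert, mem_insert, mem_singleton]
    by_cases haF' : a ∈ F'
    · rcases h3 with h | h
      · exact Or.inr (Or.inl (eq_insert_insert hcF' hcard haF' ha.2 h hzc haz))
      · exact Or.inl (eq_insert_insert hcF' hcard haF' ha.2 h hv.2 hav)
    · exact Or.inr (Or.inr (eq_insert_insert hcF' hcard (h2.resolve_right haF') hyc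
        (h1.resolve_left haF') hv.2 hyv))
  exact (card_le_card hsub).trans card_le_three

lemma card_filter_exists_insert_le {ι : Type*} [Fintype ι] {d : ℕ}
    (h𝓕 : ∀ F ∈ 𝓕, F.card = d + 1) (hc : IsMaxCertAssignment 𝓕 c)
    {H : ι → Finset (Fin n)} (hinj : Function.Injective H) (hH : ∀ i, H i ∈ 𝓕)
    {E W : Finset (Fin n)} (hE : E.card + 2 = d) (hW : Disjoint W E) :
    (univ.filter (fun i => ∃ v ∈ W, c (H i) = insert v E)).card ≤ 3 * W.card := by
  classical
  have hsub : univ.filter (fun i => ∃ v ∈ W, c (H i) = insert v E) ⊆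
      W.biUnion (fun v => univ.filter (fun i => c (H i) = insert v E)) := by
    intro i
    simp
  refine (card_le_card hsub).trans ?_
  rw [mul_comm]
  refine card_biUnion_le_card_mul _ _ _ fun v hv => ?_
  have hvE : v ∉ E := disjoint_left.1 hW hv
  refine le_trans ?_ (hc.card_filter_eq_le_three h𝓕 (C := insert v E)
    (by rw [card_insert_of_notMem hvE]; omega))
  refine card_le_card_of_injOn H (fun i hi => ?_) hinj.injOn
  simpa [hH i] using hi

/-- Two members that meet exactly in the intersection `E` of their certificates, with `E` of size
`d - 2`, witness that the union of the certificates is outside the shadow. -/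
lemma union_mem_compShadow {d : ℕ} (h𝓕 : ∀ F ∈ 𝓕, F.card = d + 1)
    {F₁ F₂ C₁ C₂ : Finset (Fin n)} (h₁ : IsCert 𝓕 F₁ C₁) (h₂ : IsCert 𝓕 F₂ C₂)
    (hinter : F₁ ∩ F₂ ⊆ C₁ ∩ C₂) (hcard : (C₁ ∪ C₂).card = d) :
    C₁ ∪ C₂ ∈ compShadow d 𝓕 := by
  simp only [compShadow, shadow', mem_sdiff, mem_powersetCard, subset_univ, hcard, true_and,
    mem_filter, mem_univ, not_exists, not_and]
  intro G hG hsub _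
  obtain ⟨y, hyG, hyF, hyC⟩ := h₁.exists_mem_inter_sdiff hG (subset_union_left.trans hsub)
  obtain ⟨z, hzG, hzF, hzC⟩ := h₂.exists_mem_inter_sdiff hG (subset_union_right.trans hsub)
  have key : ∀ w, w ∈ F₁ → w ∈ F₂ → w ∈ C₁ ∧ w ∈ C₂ := fun w hw hw' =>
    mem_inter.1 (hinter (mem_inter.2 ⟨hw, hw'⟩))
  have hy : y ∉ C₁ ∪ C₂ := by
    rw [mem_union]
    rintro (h | h)
    · exact hyC h
    · exact hyC (key y hyF (h₂.1.1 h)).1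
  have hz : z ∉ C₁ ∪ C₂ := by
    rw [mem_union]
    rintro (h | h)
    · exact hzC (key z (h₁.1.1 h) hzF).2
    · exact hzC h
  have hyz : y ≠ z := by
    rintro rfl
    exact hyC (key y hyF hzF).1
  have := card_le_card (insert_subset hyG (insert_subset hzG hsub))
  rw [card_insert_of_notMem (by simp only [mem_insert, hyz, hy, or_self, not_false_eq_true]),
    card_insert_of_notMem hz, h𝓕 G hG] at this
  omega

/-- Two members forming a pair as in the theorem meet in `d` points. -/
lemma card_inter_of_pair {d : ℕ} (hd : 1 ≤ d) (h𝓕 : ∀ F ∈ 𝓕, F.card = d + 1)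
    {F F' C C' : Finset (Fin n)} (hF : F ∈ 𝓕) (hF' : F' ∈ 𝓕) (hne : F ≠ F')
    (hC : IsCert 𝓕 F C) (hcard : C.card = d - 1) (hunion : C ∪ C' = F ∩ F') :
    (F ∩ F').card = d := by
  have hCsub : C ⊆ F ∩ F' := hunion ▸ subset_union_left
  have hlt : C.card < (F ∩ F').card := by
    refine card_lt_card (hCsub.ssubset_of_ne fun h => ?_)
    exact hC.2 F' hF' (by rw [inter_comm, h])
  have hgt : (F ∩ F').card < F.card := by
    refine card_lt_card (inter_subset_left.ssubset_of_ne fun h => hne ?_)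
    exact eq_of_subset_of_card_le (inter_eq_left.1 h) (by rw [h𝓕 F hF, h𝓕 F' hF'])
  have := h𝓕 F hF
  omega

end Certificates

lemma two_mul_card_le_card_fiber_pairs {ι α : Type*} [Fintype ι] [DecidableEq α] (f : ι → α)
    (I : Finset α) (hf : ∀ i, f i ∈ I) (M : ℝ) :
    2 * M * (Fintype.card ι : ℝ) ≤
      ((univ.filter (fun p : ι × ι => f p.1 = f p.2)).card : ℝ) + M ^ 2 * (I.card : ℝ) := by
  classical
  have h1 : Fintype.card ι = ∑ e ∈ I, (univ.filter (fun i => f i = e)).card := by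
    rw [← card_univ]
    exact card_eq_sum_card_fiberwise fun i _ => hf i
  have h2 : (univ.filter (fun p : ι × ι => f p.1 = f p.2)).card =
      ∑ e ∈ I, (univ.filter (fun i => f i = e)).card ^ 2 := by
    rw [card_eq_sum_card_fiberwise (f := fun p => f p.1) (t := I) fun p _ => hf p.1]
    refine sum_congr rfl fun e _ => ?_
    rw [sq, ← card_product]
    congr 1
    ext p
    simp only [mem_filter, mem_univ, true_and, mem_product]
    grind
  rw [h1, h2]
  push_cast
  rw [mul_sum, show M ^ 2 * (I.card : ℝ) = ∑ _e ∈ I, M ^ 2 by simp [mul_comm],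
    ← sum_add_distrib]
  refine sum_le_sum fun e _ => ?_
  nlinarith [sq_nonneg (((univ.filter (fun i => f i = e)).card : ℝ) - M)]

lemma two_mul_choose_sub_two_le (d : ℕ) (hd : 2 ≤ d) : 2 * d.choose (d - 2) ≤ d ^ 2 := by
  rw [Nat.choose_symm hd, Nat.choose_two_right]
  calc 2 * (d * (d - 1) / 2) ≤ d * (d - 1) := Nat.mul_div_le _ _
    _ ≤ d ^ 2 := by rw [sq]; exact Nat.mul_le_mul_left _ (Nat.sub_le _ _)

lemma card_filter_prod_le {ι : Type*} [Fintype ι] (r : ι → ι → Prop) [DecidableRel r] (m : ℕ)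
    (h : ∀ i, (univ.filter (fun j => r i j)).card ≤ m) :
    (univ.filter (fun p : ι × ι => r p.1 p.2)).card ≤ m * Fintype.card ι := by
  classical
  rw [card_eq_sum_card_fiberwise (f := Prod.fst) (t := univ) fun p _ => mem_univ _]
  calc _ ≤ ∑ _i : ι, m := by
        refine sum_le_sum fun i _ => le_trans ?_ (h i)
        refine card_le_card_of_injOn Prod.snd (fun p hp => ?_) fun p hp q hq hpq => ?_
        · simp only [coe_filter, mem_filter, mem_univ, true_and, Set.mem_ofPred_eq] at hp ⊢
          exact hp.2 ▸ hp.1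
        · simp only [coe_filter, mem_filter, mem_univ, true_and, Set.mem_ofPred_eq] at hp hq
          exact Prod.ext (hp.2.trans hq.2.symm) hpq
    _ = _ := by simp [mul_comm]

theorem stmt7 (n d k : ℕ) (hn : 1 ≤ n) (hd : 1 ≤ d)
    (𝓕 : Finset (Finset (Fin n))) (h𝓕 : ∀ F ∈ 𝓕, F.card = d + 1)
    (hVC : VCDimLE 𝓕 d) (c : Finset (Fin n) → Finset (Fin n))
    (hc : IsMaxCertAssignment 𝓕 c)
    (F F' : Fin k → Finset (Fin n))
    (hdistinct : ∀ i j : Fin k, (F i = F j → i = j) ∧ (F' i = F' j → i = j) ∧ F i ≠ F' j)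
    (hmem : ∀ i : Fin k, F i ∈ 𝓕 ∧ F' i ∈ 𝓕)
    (hcert : ∀ i : Fin k, (c (F i)).card = d - 1 ∧ (c (F' i)).card = d - 1 ∧
      c (F i) ∪ c (F' i) = F i ∩ F' i) :
    (2 * k : ℝ) ≤ 0.1 * ((compShadow d 𝓕).card : ℝ) + 400 * d ^ 2 * n ^ (d - 2) := by
  have hinj : Function.Injective F := fun i j h => (hdistinct i j).1 h
  have hinj' : Function.Injective F' := fun i j h => (hdistinct i j).2.1 h
  have hD : ∀ i, (F i ∩ F' i).card = d := fun i =>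
    card_inter_of_pair hd h𝓕 (hmem i).1 (hmem i).2 (hdistinct i i).2.2
      (hc _ (hmem i).1).1 (hcert i).1 (hcert i).2.2
  set E : Fin k → Finset (Fin n) := fun i => c (F i) ∩ c (F' i) with hEdef
  have hE : ∀ i, (E i).card + 2 = d := fun i => by
    have h := card_union_add_card_inter (c (F i)) (c (F' i))
    rw [(hcert i).2.2, hD i, (hcert i).1, (hcert i).2.1] at h
    simp only [hEdef]
    omega
  have hEU : ∀ i, ((F i ∪ F' i) \ E i).card = 4 := fun i => by
    have h := card_union_add_card_inter (F i) (F' i)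
    rw [hD i, h𝓕 _ (hmem i).1, h𝓕 _ (hmem i).2] at h
    have hsub : E i ⊆ F i ∪ F' i :=
      (inter_subset_left.trans (hc _ (hmem i).1).1.1.1).trans subset_union_left
    rw [card_sdiff_of_subset hsub]
    have := hE i
    omega
  have hins : ∀ i v, v ∈ c (F i) → v ∉ E i → c (F i) = insert v (E i) := fun i v hv hvE => by
    refine (eq_of_subset_of_card_le (insert_subset hv inter_subset_left) ?_).symm
    have := hE i
    rw [card_insert_of_notMem hvE, (hcert i).1]
    omega
  have hins' : ∀ i v, v ∈ c (F' i) → v ∉ E i → c (F' i) = insert v (E i) := fun i v hv hvE => by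
    refine (eq_of_subset_of_card_le (insert_subset hv inter_subset_right) ?_).symm
    have := hE i
    rw [card_insert_of_notMem hvE, (hcert i).2.1]
    omega
  rcases Nat.eq_zero_or_pos k with rfl | hk
  · simp only [CharP.cast_eq_zero, mul_zero]
    positivity
  have hd2 : 2 ≤ d := by
    have := hE ⟨0, hk⟩
    omega
  set r : Fin k → Fin k → Prop := fun i j => E i = E j ∧ ¬ ((F j ∩ F' j) ∩ (F i ∪ F' i) ⊆ E i)
    with hr
  -- `r i j` holds for few `j`
  have hrcard : ∀ i, (univ.filter (fun j => r i j)).card ≤ 24 := fun i => by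
    have hdis : Disjoint ((F i ∪ F' i) \ E i) (E i) := sdiff_disjoint
    have hA := card_filter_exists_insert_le h𝓕 hc hinj (fun i => (hmem i).1) (hE i) hdis
    have hB := card_filter_exists_insert_le h𝓕 hc hinj' (fun i => (hmem i).2) (hE i) hdis
    rw [hEU i] at hA hB
    refine le_trans (card_le_card fun j hj => ?_)
      ((card_union_le _ _).trans (Nat.add_le_add hA hB))
    simp only [mem_filter, mem_univ, true_and, hr, not_subset] at hj
    obtain ⟨hij, v, hv, hvE⟩ := hj
    rw [mem_inter, ← (hcert j).2.2, mem_union] at hv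
    have hvU : v ∈ (F i ∪ F' i) \ E i := mem_sdiff.2 ⟨hv.2, hvE⟩
    simp only [mem_union, mem_filter, mem_univ, true_and]
    rcases hv.1 with h | h
    · exact Or.inl ⟨v, hvU, hij ▸ hins j v h (hij ▸ hvE)⟩
    · exact Or.inr ⟨v, hvU, hij ▸ hins' j v h (hij ▸ hvE)⟩
  have hbad := card_filter_prod_le r 24 hrcard
  have hbad' : (univ.filter (fun p : Fin k × Fin k => r p.2 p.1)).card ≤
      24 * Fintype.card (Fin k) := by
    refine le_trans (card_le_card_of_injOn Prod.swap (fun p hp => ?_)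
      Prod.swap_injective.injOn) hbad
    simpa using hp
  set T := compShadow d 𝓕 with hT
  -- the other pairs with equal `E` produce sets outside the shadow
  have hsplit : ∀ {A C : Finset (Fin n)}, A ⊆ C → C.card = d - 1 → A.card + 2 = d →
      ∃ v, v ∉ A ∧ C = insert v A := fun {A C} hAC hC hA => by
    obtain ⟨v, hvA, hv⟩ := exists_eq_insert_iff.2 ⟨hAC, (by omega : A.card + 1 = C.card)⟩
    exact ⟨v, hvA, hv.symm⟩
  have hwit : ∀ i H, H ∈ 𝓕 → (c H).card = d - 1 → E i ⊆ c H → F i ∩ H ⊆ E i →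
      ∃ S ∈ T, E i ∈ powersetCard (d - 2) S ∧ (∃ v ∈ S \ E i, c (F i) = insert v (E i)) ∧
        ∃ v ∈ S \ E i, c H = insert v (E i) := fun i H hH hHc hEH hFH => by
    have hEF : E i ⊆ c (F i) := inter_subset_left
    have hCi := (hc _ (hmem i).1).1
    have hCH := (hc _ hH).1
    have hEi := hE i
    have hinter : c (F i) ∩ c H = E i :=
      Subset.antisymm ((inter_subset_inter hCi.1.1 hCH.1.1).trans hFH) (subset_inter hEF hEH)
    have hcard : (c (F i) ∪ c H).card = d := by
      have := card_union_add_card_inter (c (F i)) (c H)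
      rw [hinter, hHc, (hcert i).1] at this
      omega
    obtain ⟨v, hv, hvF⟩ := hsplit hEF (hcert i).1 hEi
    obtain ⟨w, hw, hwH⟩ := hsplit hEH hHc hEi
    refine ⟨_, union_mem_compShadow h𝓕 hCi hCH (hinter.symm ▸ hFH) hcard,
      mem_powersetCard.2 ⟨hEF.trans subset_union_left, by omega⟩,
      ⟨v, mem_sdiff.2 ⟨mem_union_left _ ?_, hv⟩, hvF⟩,
      ⟨w, mem_sdiff.2 ⟨mem_union_right _ ?_, hw⟩, hwH⟩⟩
    · rw [hvF]
      exact mem_insert_self _ _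
    · rw [hwH]
      exact mem_insert_self _ _
  have hgood : ∀ i j, E i = E j → ¬ r i j → ¬ r j i →
      ∃ S ∈ T, E i ∈ powersetCard (d - 2) S ∧ (∃ v ∈ S \ E i, c (F i) = insert v (E i)) ∧
        ((∃ v ∈ S \ E i, c (F j) = insert v (E i)) ∨
          ∃ v ∈ S \ E i, c (F' j) = insert v (E i)) := by
    intro i j hij h1 h2
    simp only [hr, not_and, not_not] at h1 h2
    replace h1 := h1 hij
    replace h2 := h2 hij.symm
    by_cases hi : F i ∩ F j ⊆ E i
    · obtain ⟨S, hS, hES, hv, hw⟩ := hwit i (F j) (hmem j).1 (hcert j).1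
        (hij ▸ inter_subset_left) hi
      exact ⟨S, hS, hES, hv, Or.inl hw⟩
    by_cases hi' : F i ∩ F' j ⊆ E i
    · obtain ⟨S, hS, hES, hv, hw⟩ := hwit i (F' j) (hmem j).2 (hcert j).2.1
        (hij ▸ inter_subset_right) hi'
      exact ⟨S, hS, hES, hv, Or.inr hw⟩
    exfalso
    obtain ⟨y, hy, hyE⟩ := not_subset.1 hi
    obtain ⟨z, hz, hzE⟩ := not_subset.1 hi'
    rw [mem_inter] at hy hz
    have hnot : ∀ w ∈ F i, w ∈ F j ∪ F' j → w ∉ E i → w ∈ F i \ F' i := fun w hw hwj hwE =>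
      mem_sdiff.2 ⟨hw, fun hw' => hwE (hij ▸ h2 (mem_inter.2 ⟨mem_inter.2 ⟨hw, hw'⟩, hwj⟩))⟩
    have hone : (F i \ F' i).card ≤ 1 := by
      have := card_sdiff_add_card_inter (F i) (F' i)
      rw [hD i, h𝓕 _ (hmem i).1] at this
      omega
    have hyz : y = z := card_le_one.1 hone y (hnot y hy.1 (mem_union_left _ hy.2) hyE)
      z (hnot z hz.1 (mem_union_right _ hz.2) hzE)
    subst hyz
    exact hyE (h1 (mem_inter.2 ⟨mem_inter.2 ⟨hy.2, hz.2⟩, mem_union_left _ hy.1⟩))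
  set A : Finset (Fin n) → Finset (Fin n) → Finset (Fin k) :=
    fun S B => univ.filter (fun i => ∃ v ∈ S \ B, c (F i) = insert v B) with hA
  set A' : Finset (Fin n) → Finset (Fin n) → Finset (Fin k) :=
    fun S B => univ.filter (fun i => ∃ v ∈ S \ B, c (F' i) = insert v B) with hA'
  set Q : Finset (Fin k × Fin k) :=
    T.biUnion (fun S => (powersetCard (d - 2) S).biUnion (fun B => A S B ×ˢ (A S B ∪ A' S B)))
    with hQ
  have hTcard : ∀ S ∈ T, S.card = d := fun S hS =>
    (mem_powersetCard.1 (mem_sdiff.1 hS).1).2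
  have hQcard : Q.card ≤ T.card * (d.choose (d - 2) * 72) := by
    refine card_biUnion_le_card_mul _ _ _ fun S hS => ?_
    have hSd := hTcard S hS
    rw [← hSd, ← card_powersetCard (S.card - 2) S, hSd]
    refine card_biUnion_le_card_mul _ _ _ fun B hB => ?_
    rw [mem_powersetCard] at hB
    have hB2 : B.card + 2 = d := by omega
    have hSB : (S \ B).card = 2 := by
      rw [card_sdiff_of_subset hB.1]
      omega
    have h1 : (A S B).card ≤ 6 := by
      have := card_filter_exists_insert_le h𝓕 hc hinj (fun i => (hmem i).1) hB2
        (sdiff_disjoint : Disjoint (S \ B) B)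
      rwa [hSB] at this
    have h2 : (A' S B).card ≤ 6 := by
      have := card_filter_exists_insert_le h𝓕 hc hinj' (fun i => (hmem i).2) hB2
        (sdiff_disjoint : Disjoint (S \ B) B)
      rwa [hSB] at this
    rw [card_product]
    exact Nat.mul_le_mul h1 ((card_union_le _ _).trans (Nat.add_le_add h1 h2))
  have hpairs : (univ.filter (fun p : Fin k × Fin k => E p.1 = E p.2)).card ≤
      T.card * (d.choose (d - 2) * 72) + 48 * k := by
    have hsub : univ.filter (fun p : Fin k × Fin k => E p.1 = E p.2) ⊆
        Q ∪ (univ.filter (fun p : Fin k × Fin k => r p.1 p.2) ∪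
          univ.filter (fun p : Fin k × Fin k => r p.2 p.1)) := by
      rintro ⟨i, j⟩ hp
      simp only [mem_filter, mem_univ, true_and] at hp
      simp only [mem_union, mem_filter, mem_univ, true_and]
      by_contra! hcon
      obtain ⟨S, hS, hES, hv, hw⟩ := hgood i j hp hcon.2.1 hcon.2.2
      refine hcon.1 (mem_biUnion.2 ⟨S, hS, mem_biUnion.2 ⟨E i, hES, mem_product.2 ⟨?_, ?_⟩⟩⟩)
      · simpa [hA] using hv
      · simpa [hA, hA'] using hw
    have h1 := card_le_card hsub
    have h2 := card_union_le Q (univ.filter (fun p : Fin k × Fin k => r p.1 p.2) ∪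
      univ.filter (fun p : Fin k × Fin k => r p.2 p.1))
    have h3 := card_union_le (univ.filter (fun p : Fin k × Fin k => r p.1 p.2))
      (univ.filter (fun p : Fin k × Fin k => r p.2 p.1))
    rw [Fintype.card_fin] at hbad hbad'
    omega
  have hchoose := two_mul_choose_sub_two_le d hd2
  have hupper : (univ.filter (fun p : Fin k × Fin k => E p.1 = E p.2)).card ≤
      36 * d ^ 2 * T.card + 48 * k := by
    refine hpairs.trans (Nat.add_le_add_right ?_ _)
    calc T.card * (d.choose (d - 2) * 72) = 36 * (2 * d.choose (d - 2)) * T.card := by ring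
      _ ≤ 36 * d ^ 2 * T.card := by gcongr
  have hlower := two_mul_card_le_card_fiber_pairs E (powersetCard (d - 2) univ)
    (fun i => mem_powersetCard.2 ⟨subset_univ _, by have := hE i; omega⟩) (380 * (d : ℝ) ^ 2)
  have hN : ((powersetCard (d - 2) (univ : Finset (Fin n))).card : ℝ) ≤ (n : ℝ) ^ (d - 2) := by
    rw [card_powersetCard, card_univ, Fintype.card_fin]
    exact_mod_cast Nat.choose_le_pow n (d - 2)
  have hupper' : ((univ.filter (fun p : Fin k × Fin k => E p.1 = E p.2)).card : ℝ) ≤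
      36 * (d : ℝ) ^ 2 * T.card + 48 * k := by exact_mod_cast hupper
  rw [Fintype.card_fin] at hlower
  have hd4 : (4 : ℝ) ≤ (d : ℝ) ^ 2 := by
    have : (2 : ℝ) ≤ d := by exact_mod_cast hd2
    nlinarith
  have hk0 : (0 : ℝ) ≤ k := Nat.cast_nonneg k
  have hT0 : (0 : ℝ) ≤ T.card := Nat.cast_nonneg _
  have hN0 : (0 : ℝ) ≤ (n : ℝ) ^ (d - 2) := by positivity
  have hx0 : (0 : ℝ) < (d : ℝ) ^ 2 := by linarith
  generalize (d : ℝ) ^ 2 = x at *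
  generalize (n : ℝ) ^ (d - 2) = N at *
  have hmul : x * (748 * k) ≤ x * (36 * T.card + 144400 * x * N) := by
    have h1 : (380 * x) ^ 2 * ((powersetCard (d - 2) (univ : Finset (Fin n))).card : ℝ) ≤
        (380 * x) ^ 2 * N := mul_le_mul_of_nonneg_left hN (by positivity)
    have h2 : 4 * (k : ℝ) ≤ x * k := mul_le_mul_of_nonneg_right hd4 hk0
    linarith
  have hdiv := le_of_mul_le_mul_left hmul hx0
  have hxN : 0 ≤ x * N := by positivity
  linarith
end

section
/- Let n and d be positive integers with d ≥ 2, let 𝓕 ⊆ binom([n], d+1) be a family with VC-dimension at most d, let 𝓖 ⊆ 𝓕, and let c be an assignment of maximum 𝓖-certificates of the sets in 𝓖 such that d−1 ≤ |c(F)| ≤ d for every F ∈ 𝓖. Then for any two distinct elements i, j ∈ [n], the family 𝓖(i,j) := {F ∈ 𝓖 : {i,j} ⊆ F and |c(F) \ {i,j}| ≤ d−2} satisfies |𝓖(i,j)| ≤ 9·binom(n−1, d−2). -/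
open Finset

theorem exists_mem_inter_of_isCert {n : ℕ} {𝓖 : Finset (Finset (Fin n))}
    {F F' T : Finset (Fin n)} (hT : IsCert 𝓖 F T) (hF' : F' ∈ 𝓖) (hTF' : T ⊆ F') :
    ∃ x ∈ F', x ∈ F ∧ x ∉ T := by
  by_contra! h
  refine hT.2 F' hF' (Subset.antisymm (fun x hx => ?_) (subset_inter hTF' hT.1.1))
  exact h x (mem_inter.1 hx).1 (mem_inter.1 hx).2

theorem eq_insert_insert_of_card {n : ℕ} {F T : Finset (Fin n)} {p q : Fin n}
    (hcard : F.card = T.card + 2) (hTF : T ⊆ F) (hp : p ∈ F) (hq : q ∈ F)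
    (hpT : p ∉ T) (hqT : q ∉ T) (hpq : p ≠ q) : F = insert p (insert q T) := by
  refine (eq_of_subset_of_card_le ?_ ?_).symm
  · simp [insert_subset_iff, hTF, hp, hq]
  · rw [card_insert_of_notMem (by simp [hpT, hpq]), card_insert_of_notMem hqT, hcard]

/-- If no certificate of `F` has `d` elements, some member of the family consists of `F`
with `b` replaced by a new element. -/
theorem exists_eq_insert_erase {n d : ℕ} {𝓖 : Finset (Finset (Fin n))}
    (h𝓖 : ∀ F ∈ 𝓖, F.card = d + 1) {F : Finset (Fin n)} (hF : F ∈ 𝓖)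
    (hmax : ∀ T, IsCert 𝓖 F T → T.card < d) {b : Fin n} (hb : b ∈ F) :
    ∃ x ∉ F, insert x (F.erase b) ∈ 𝓖 := by
  have hcard : (F.erase b).card = d := by rw [card_erase_of_mem hb, h𝓖 F hF]; rfl
  have hnot : ¬ IsCert 𝓖 F (F.erase b) := fun h => (hmax _ h).ne hcard
  obtain ⟨F', hF', hinter⟩ : ∃ F' ∈ 𝓖, F' ∩ F = F.erase b := by
    by_contra! h
    exact hnot ⟨erase_ssubset hb, h⟩
  have hsdiff : (F' \ F).card = 1 := by
    have := card_sdiff_add_card_inter F' F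
    rw [hinter, hcard, h𝓖 F' hF'] at this
    omega
  obtain ⟨x, hx⟩ := card_eq_one.1 hsdiff
  have hxF : x ∈ F' \ F := by simp [hx]
  refine ⟨x, (mem_sdiff.1 hxF).2, ?_⟩
  rwa [← hinter, insert_eq, ← hx, sdiff_union_inter]

/-- In a `(d + 1)`-uniform family, a set with at least `d - 1` elements is the chosen maximum
certificate of at most three members. -/
theorem card_filter_maxCert_eq_le_three {n d : ℕ} {𝓖 : Finset (Finset (Fin n))}
    (h𝓖 : ∀ F ∈ 𝓖, F.card = d + 1) {c : Finset (Fin n) → Finset (Fin n)}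
    (hc : IsMaxCertAssignment 𝓖 c) {T : Finset (Fin n)} (hT : d ≤ T.card + 1) :
    (𝓖.filter (fun F => c F = T)).card ≤ 3 := by
  rcases (𝓖.filter (fun F => c F = T)).eq_empty_or_nonempty with h | ⟨F₀, hF₀⟩
  · simp [h]
  obtain ⟨hF₀, hcF₀⟩ := mem_filter.1 hF₀
  have hcert : ∀ F ∈ 𝓖, c F = T → IsCert 𝓖 F T := fun F hF h => h ▸ (hc F hF).1
  have hT₀ := hcert F₀ hF₀ hcF₀
  have hlt : T.card < d + 1 := h𝓖 F₀ hF₀ ▸ card_lt_card hT₀.1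
  rcases (show T.card = d ∨ T.card + 1 = d by omega) with hTd | hTd
  · suffices 𝓖.filter (fun F => c F = T) ⊆ {F₀} from
      (card_le_card this).trans (by simp)
    intro F hF
    obtain ⟨hF, hcF⟩ := mem_filter.1 hF
    obtain ⟨x, hxF, hx₀, hxT⟩ := exists_mem_inter_of_isCert hT₀ hF (hcert F hF hcF).1.1
    have key : ∀ G ∈ 𝓖, T ⊆ G → x ∈ G → insert x T = G := fun G hG hTG hxG =>
      eq_of_subset_of_card_le (insert_subset hxG hTG)
        (by rw [card_insert_of_notMem hxT, h𝓖 G hG, hTd])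
    rw [mem_singleton, ← key F hF (hcert F hF hcF).1.1 hxF, key F₀ hF₀ hT₀.1.1 hx₀]
  · have hmax : ∀ S, IsCert 𝓖 F₀ S → S.card < d := fun S hS => by
      have := (hc F₀ hF₀).2 S hS
      rw [hcF₀] at this
      omega
    have hab : (F₀ \ T).card = 2 := by
      rw [card_sdiff_of_subset hT₀.1.1, h𝓖 F₀ hF₀]; omega
    obtain ⟨a, b, hne, hab⟩ := card_eq_two.1 hab
    have hmem : ∀ z, z ∈ F₀ ∧ z ∉ T ↔ z = a ∨ z = b := fun z => by
      rw [← mem_sdiff, hab]; simp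
    obtain ⟨ha, haT⟩ := (hmem a).2 (Or.inl rfl)
    obtain ⟨hb, hbT⟩ := (hmem b).2 (Or.inr rfl)
    obtain ⟨x, hx, hFx⟩ := exists_eq_insert_erase h𝓖 hF₀ hmax hb
    obtain ⟨y, hy, hFy⟩ := exists_eq_insert_erase h𝓖 hF₀ hmax ha
    have hsub : ∀ u v, v ∉ T → T ⊆ insert u (F₀.erase v) := fun u v hv =>
      (subset_erase.2 ⟨hT₀.1.1, hv⟩).trans (subset_insert _ _)
    suffices 𝓖.filter (fun F => c F = T) ⊆
        {F₀, insert a (insert y T), insert b (insert x T)} from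
      (card_le_card this).trans card_le_three
    intro F hF
    obtain ⟨hF, hcF⟩ := mem_filter.1 hF
    have hTF := hcert F hF hcF
    have hcard : ∀ G ∈ 𝓖, G.card = T.card + 2 := fun G hG => by rw [h𝓖 G hG]; omega
    have key := fun p q => eq_insert_insert_of_card (p := p) (q := q) (hcard F hF) hTF.1.1
    have h₀ : a ∈ F ∨ b ∈ F := by
      obtain ⟨z, hz, hzF, hzT⟩ := exists_mem_inter_of_isCert hTF hF₀ hT₀.1.1
      rcases (hmem z).1 ⟨hz, hzT⟩ with rfl | rfl <;> simp [hzF]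
    have h₁ : x ∈ F ∨ a ∈ F := by
      obtain ⟨z, hz, hzF, hzT⟩ := exists_mem_inter_of_isCert hTF hFx (hsub x b hbT)
      have := hmem z
      grind
    have h₂ : y ∈ F ∨ b ∈ F := by
      obtain ⟨z, hz, hzF, hzT⟩ := exists_mem_inter_of_isCert hTF hFy (hsub y a haT)
      have := hmem z
      grind
    have hxT : x ∉ T := fun h => hx (hT₀.1.1 h)
    have hyT : y ∉ T := fun h => hy (hT₀.1.1 h)
    simp only [mem_insert, mem_singleton]
    by_cases haF : a ∈ F
    · by_cases hbF : b ∈ F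
      · left
        rw [key a b haF hbF haT hbT hne]
        exact (eq_insert_insert_of_card (hcard F₀ hF₀) hT₀.1.1 ha hb haT hbT hne).symm
      · exact Or.inr (Or.inl (key a y haF (h₂.resolve_right hbF) haT hyT
          (fun h => hy (h ▸ ha))))
    · exact Or.inr (Or.inr (key b x (h₀.resolve_left haF) (h₁.resolve_right haF) hbT hxT
        (fun h => hx (h ▸ hb))))

/-- There are at most `3 * (n - 1).choose (d - 2)` sets with `d - 1` or `d` elements of which at
most `d - 2` lie outside `{i, j}`. -/
theorem card_le_three_mul_choose {n d : ℕ} (hd : 2 ≤ d) {i j : Fin n} (hij : i ≠ j)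
    {𝓣 : Finset (Finset (Fin n))}
    (h𝓣 : ∀ T ∈ 𝓣, d - 1 ≤ T.card ∧ T.card ≤ d ∧ (T \ {i, j}).card ≤ d - 2) :
    𝓣.card ≤ 3 * (n - 1).choose (d - 2) := by
  have hpow : ∀ k : Fin n,
      (powersetCard (d - 2) (univ.erase k)).card = (n - 1).choose (d - 2) := fun k => by
    rw [card_powersetCard, card_erase_of_mem (mem_univ k), card_univ, Fintype.card_fin]
  let 𝓤 := (powersetCard (d - 2) (univ.erase i)).image (insert i)
  let 𝓥 := (powersetCard (d - 2) (univ.erase j)).image (insert j)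
  let 𝓦 := (powersetCard (d - 2) (univ.erase i)).image (fun U => insert i (insert j U))
  have hsub : 𝓣 ⊆ 𝓤 ∪ 𝓥 ∪ 𝓦 := by
    intro T hT
    obtain ⟨h₁, h₂, h₃⟩ := h𝓣 T hT
    have hinter := card_sdiff_add_card_inter T {i, j}
    have hsingle : ∀ k ∈ T, T.card = d - 1 →
        T ∈ (powersetCard (d - 2) (univ.erase k)).image (insert k) := fun k hk hcard =>
      mem_image.2 ⟨T.erase k, mem_powersetCard.2 ⟨erase_subset_erase _ (subset_univ _),
        by rw [card_erase_of_mem hk, hcard]; omega⟩, insert_erase hk⟩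
    rcases (show T.card = d - 1 ∨ T.card = d by omega) with hcard | hcard
    · obtain ⟨k, hk⟩ : (T ∩ {i, j}).Nonempty := card_pos.1 (by omega)
      obtain ⟨hkT, hk⟩ := mem_inter.1 hk
      rcases mem_insert.1 hk with rfl | hk
      · exact mem_union_left _ (mem_union_left _ (hsingle k hkT hcard))
      · obtain rfl := mem_singleton.1 hk
        exact mem_union_left _ (mem_union_right _ (hsingle k hkT hcard))
    · have hpair : T ∩ {i, j} = {i, j} :=
        eq_of_subset_of_card_le inter_subset_right (by rw [card_pair hij]; omega)
      have hle : {i, j} ⊆ T := inter_eq_right.1 hpair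
      rw [hpair, card_pair hij] at hinter
      refine mem_union_right _ (mem_image.2 ⟨T \ {i, j}, mem_powersetCard.2 ⟨?_, by omega⟩, ?_⟩)
      · intro z hz
        simp only [mem_sdiff, mem_insert, mem_singleton, not_or] at hz
        simp [hz.2.1]
      · have hunion := union_sdiff_of_subset hle
        rwa [insert_union, singleton_union] at hunion
  have hU : 𝓤.card ≤ _ := card_image_le.trans (hpow i).le
  have hV : 𝓥.card ≤ _ := card_image_le.trans (hpow j).le
  have hW : 𝓦.card ≤ _ := card_image_le.trans (hpow i).le
  have h₁ := card_le_card hsub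
  have h₂ := card_union_le (𝓤 ∪ 𝓥) 𝓦
  have h₃ := card_union_le 𝓤 𝓥
  omega

theorem stmt9 (n d : ℕ) (hn : 1 ≤ n) (hd : 2 ≤ d)
    (𝓕 𝓖 : Finset (Finset (Fin n))) (h𝓕 : ∀ F ∈ 𝓕, F.card = d + 1)
    (hVC : VCDimLE 𝓕 d) (h𝓖 : 𝓖 ⊆ 𝓕)
    (c : Finset (Fin n) → Finset (Fin n)) (hc : IsMaxCertAssignment 𝓖 c)
    (hcsize : ∀ F ∈ 𝓖, d - 1 ≤ (c F).card ∧ (c F).card ≤ d)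
    (i j : Fin n) (hij : i ≠ j) :
    (𝓖.filter (fun F => i ∈ F ∧ j ∈ F ∧ (c F \ {i, j}).card ≤ d - 2)).card
      ≤ 9 * (n - 1).choose (d - 2) := by
  have huniform : ∀ F ∈ 𝓖, F.card = d + 1 := fun F hF => h𝓕 F (h𝓖 hF)
  set 𝓗 := 𝓖.filter (fun F => i ∈ F ∧ j ∈ F ∧ (c F \ {i, j}).card ≤ d - 2)
  have hfiber : 𝓗.card ≤ 3 * (𝓗.image c).card := by
    refine card_le_mul_card_image 𝓗 3 fun T hT => ?_
    obtain ⟨F, hF, rfl⟩ := mem_image.1 hT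
    have hcF := (hcsize F (mem_filter.1 hF).1).1
    exact (card_le_card (filter_subset_filter _ (filter_subset _ _))).trans
      (card_filter_maxCert_eq_le_three huniform hc (by omega))
  have himage : (𝓗.image c).card ≤ 3 * (n - 1).choose (d - 2) := by
    refine card_le_three_mul_choose hd hij fun T hT => ?_
    obtain ⟨F, hF, rfl⟩ := mem_image.1 hT
    obtain ⟨hF, -, -, hcF⟩ := mem_filter.1 hF
    exact ⟨(hcsize F hF).1, (hcsize F hF).2, hcF⟩
  omega
end

section
/- For every positive integer d with d ≥ 2 there exist constants C and n₀ depending only on d such that the following holds for all n ≥ n₀. Let 𝓕 ⊆ binom([n], d+1) be a family with VC-dimension at most d, let 𝓖 ⊆ 𝓕, and let c be an assignment of maximum 𝓖-certificates of the sets in 𝓖 such that d−1 ≤ |c(F)| ≤ d for every F ∈ 𝓖. Then there exist distinct elements i, j ∈ [n] such that: (i) |{D ∈ ∂̄𝓖 : D ∩ {i,j} = ∅}| ≥ (1 − 8d/n)·|∂̄𝓖|; (ii) the families 𝓖_{d−1}(i) := {F ∈ 𝓖 : i ∈ F and |c(F)| = d−1}, 𝓖_{d−1}(j) := {F ∈ 𝓖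 : j ∈ F and |c(F)| = d−1}, and 𝓖(i,j) := {F ∈ 𝓖 : {i,j} ⊆ F and |c(F) \ {i,j}| ≤ d−2} each have size at most C·n^{d−2}. -/
open Finset

/-- Markov's inequality: at most a quarter of the values exceed four times the average. -/
lemma four_mul_card_filter_lt_le {n : ℕ} (f : Fin n → ℕ) (M : ℕ)
    (h : 4 * ∑ i, f i ≤ n * M) : 4 * (univ.filter (fun i => M < f i)).card ≤ n := by
  have h1 : (univ.filter (fun i => M < f i)).card * (M + 1) ≤ ∑ i, f i := by
    calc (univ.filter (fun i => M < f i)).card * (M + 1)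
        ≤ ∑ i ∈ univ.filter (fun i => M < f i), f i := by
          rw [← smul_eq_mul]
          exact card_nsmul_le_sum _ _ _ fun i hi => (mem_filter.1 hi).2
      _ ≤ ∑ i, f i := sum_le_sum_of_subset (filter_subset _ _)
  by_contra! hlt
  nlinarith

lemma sum_card_filter_mem {n k : ℕ} (H : Finset (Finset (Fin n))) (hH : ∀ F ∈ H, F.card = k) :
    ∑ i, (H.filter (fun F => i ∈ F)).card = k * H.card := by
  have := sum_card_bipartiteAbove_eq_sum_card_bipartiteBelow (s := (univ : Finset (Fin n)))
    (t := H) (fun i F => i ∈ F)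
  simp only [bipartiteAbove, bipartiteBelow, filter_univ_mem] at this
  rw [this, sum_congr rfl hH, sum_const, smul_eq_mul, mul_comm]

/-- At most `2 ^ (3 * (d + 1))` members share a given maximum certificate of size `d - 1`. -/
lemma card_filter_cert_eq_le {n d : ℕ} (hd : 1 ≤ d) {𝓖 : Finset (Finset (Fin n))}
    (hcard : ∀ F ∈ 𝓖, F.card = d + 1) {c : Finset (Fin n) → Finset (Fin n)}
    (hc : IsMaxCertAssignment 𝓖 c) {T : Finset (Fin n)} (hT : T.card = d - 1) :
    (𝓖.filter (fun F => c F = T)).card ≤ 2 ^ (3 * (d + 1)) := by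
  rcases (𝓖.filter (fun F => c F = T)).eq_empty_or_nonempty with h | ⟨F, hF⟩
  · simp [h]
  obtain ⟨hFG, hFT⟩ := mem_filter.1 hF
  have hTF : T ⊆ F := hFT ▸ (hc F hFG).1.1.subset
  have hdiff : (F \ T).card = 2 := by
    rw [card_sdiff_of_subset hTF, hcard F hFG]; omega
  obtain ⟨a, b, hab, hFab⟩ := card_eq_two.1 hdiff
  have ha : a ∈ F ∧ a ∉ T := mem_sdiff.1 (hFab ▸ mem_insert_self a {b})
  have hb : b ∈ F ∧ b ∉ T := mem_sdiff.1 (hFab ▸ by simp)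
  have extend : ∀ x ∈ F, x ∉ T → ∃ F' ∈ 𝓖, F' ∩ F = insert x T := by
    intro x hx hxT
    by_contra! hne
    have hsub : insert x T ⊆ F := insert_subset hx hTF
    have hx' : (insert x T).card = d := by rw [card_insert_of_notMem hxT]; omega
    have := (hc F hFG).2 (insert x T)
      ⟨hsub.ssubset_of_ne (by rintro h; have := hcard F hFG; rw [← h] at this; omega), hne⟩
    rw [hFT] at this
    omega
  obtain ⟨F₁, hF₁, h₁⟩ := extend a ha.1 ha.2
  obtain ⟨F₂, hF₂, h₂⟩ := extend b hb.1 hb.2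
  have hTi : ∀ x ∈ F, x ∈ F₁ → x ∈ F₂ → x ∈ T := by
    intro x hx hx1 hx2
    have e1 : x ∈ insert a T := h₁ ▸ mem_inter.2 ⟨hx1, hx⟩
    have e2 : x ∈ insert b T := h₂ ▸ mem_inter.2 ⟨hx2, hx⟩
    grind
  have hTF₁ : T ⊆ F₁ := fun x hx =>
    (mem_inter.1 (h₁ ▸ mem_insert_of_mem hx : x ∈ F₁ ∩ F)).1
  have hTF₂ : T ⊆ F₂ := fun x hx =>
    (mem_inter.1 (h₂ ▸ mem_insert_of_mem hx : x ∈ F₂ ∩ F)).1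
  have hsub : 𝓖.filter (fun F => c F = T) ⊆ (F ∪ F₁ ∪ F₂).powerset := by
    intro F' hF'
    obtain ⟨hF'G, hF'T⟩ := mem_filter.1 hF'
    have hTF' : T ⊆ F' := hF'T ▸ (hc F' hF'G).1.1.subset
    rw [mem_powerset]
    by_contra hnot
    obtain ⟨y, hy, hyU⟩ := not_subset.1 hnot
    have hle : (F' ∩ (F ∪ F₁ ∪ F₂)).card ≤ d := by
      have : F' ∩ (F ∪ F₁ ∪ F₂) ⊂ F' :=
        inter_subset_left.ssubset_of_ne fun h => hyU (mem_inter.1 (h.symm ▸ hy)).2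
      have := card_lt_card this
      rw [hcard F' hF'G] at this
      omega
    have key : ∀ E ∈ 𝓖, T ⊆ E → E ⊆ F ∪ F₁ ∪ F₂ → F' ∩ (F ∪ F₁ ∪ F₂) ⊆ E := by
      intro E hE hTE hEU
      have hne : E ∩ F' ≠ T := hF'T ▸ (hc F' hF'G).1.2 E hE
      have hss : T ⊂ E ∩ F' := (subset_inter hTE hTF').ssubset_of_ne hne.symm
      have h3 := card_lt_card hss
      have h4 : E ∩ F' ⊆ F' ∩ (F ∪ F₁ ∪ F₂) := fun x hx =>
        mem_inter.2 ⟨(mem_inter.1 hx).2, hEU (mem_inter.1 hx).1⟩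
      have h5 := eq_of_subset_of_card_le h4 (by omega)
      exact h5 ▸ inter_subset_left
    have k0 := key F hFG hTF (by grind)
    have k1 := key F₁ hF₁ hTF₁ (by grind)
    have k2 := key F₂ hF₂ hTF₂ (by grind)
    refine (hc F' hF'G).1.2 F hFG ?_
    rw [hF'T]
    refine Subset.antisymm (fun x hx => ?_) (subset_inter hTF hTF')
    have hxU : x ∈ F' ∩ (F ∪ F₁ ∪ F₂) := by grind
    exact hTi x (k0 hxU) (k1 hxU) (k2 hxU)
  refine (card_le_card hsub).trans ?_
  rw [card_powerset]
  refine Nat.pow_le_pow_right (by norm_num) ?_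
  have u1 := card_union_le (F ∪ F₁) F₂
  have u2 := card_union_le F F₁
  rw [hcard _ hFG, hcard _ hF₁] at u2
  rw [hcard _ hF₂] at u1
  omega

lemma card_filter_card_cert_eq_le {n d : ℕ} (hd : 1 ≤ d) {𝓖 : Finset (Finset (Fin n))}
    (hcard : ∀ F ∈ 𝓖, F.card = d + 1) {c : Finset (Fin n) → Finset (Fin n)}
    (hc : IsMaxCertAssignment 𝓖 c) :
    (𝓖.filter (fun F => (c F).card = d - 1)).card ≤ 2 ^ (3 * (d + 1)) * n ^ (d - 1) := by
  have h := card_le_mul_card_image_of_maps_to (s := 𝓖.filter (fun F => (c F).card = d - 1))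
    (t := powersetCard (d - 1) univ) (f := c)
    (fun F hF => by simpa using (mem_filter.1 hF).2) (2 ^ (3 * (d + 1)))
    (fun T hT => (card_le_card (by grind)).trans
      (card_filter_cert_eq_le hd hcard hc (mem_powersetCard.1 hT).2))
  refine h.trans (Nat.mul_le_mul_left _ ?_)
  rw [card_powersetCard, card_univ, Fintype.card_fin]
  exact Nat.choose_le_pow n (d - 1)

/-- Certificates of full size `d` determine the set they certify. -/
lemma injOn_cert_of_card_eq {n d : ℕ} {𝓖 : Finset (Finset (Fin n))}
    (hcard : ∀ F ∈ 𝓖, F.card = d + 1) {c : Finset (Fin n) → Finset (Fin n)}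
    (hc : IsMaxCertAssignment 𝓖 c) :
    Set.InjOn c {F | F ∈ 𝓖 ∧ (c F).card = d} := by
  rintro F ⟨hF, hFc⟩ F' ⟨hF', -⟩ h
  by_contra hne
  have hsub : c F ⊆ F' ∩ F :=
    subset_inter (h ▸ (hc F' hF').1.1.subset) (hc F hF).1.1.subset
  have hss : F' ∩ F ⊂ F := inter_subset_right.ssubset_of_ne fun e =>
    hne (eq_of_subset_of_card_le (inter_eq_right.1 e) (by rw [hcard F hF, hcard F' hF']))
  have hlt := card_lt_card hss
  rw [hcard F hF] at hlt
  exact (hc F hF).1.2 F' hF' (eq_of_subset_of_card_le hsub (by omega)).symm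

lemma card_filter_superset_pair_le {n d : ℕ} {i j : Fin n} (hij : i ≠ j) :
    ((powersetCard d (univ : Finset (Fin n))).filter (fun D => {i, j} ⊆ D)).card
      ≤ n ^ (d - 2) := by
  calc _ ≤ (powersetCard (d - 2) (univ : Finset (Fin n))).card := by
        refine card_le_card_of_injOn (fun D => D \ {i, j}) ?_ ?_
        · intro D hD
          simp only [coe_filter, Set.mem_ofPred_eq, mem_powersetCard] at hD
          simp [card_sdiff_of_subset hD.2, card_pair hij, hD.1.2]
        · intro D hD D' hD' h
          simp only [coe_filter, Set.mem_ofPred_eq] at hD hD'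
          rw [← sdiff_union_of_subset hD.2, ← sdiff_union_of_subset hD'.2]
          exact congrArg (· ∪ {i, j}) h
    _ ≤ n ^ (d - 2) := by
        rw [card_powersetCard, card_univ, Fintype.card_fin]
        exact Nat.choose_le_pow n (d - 2)

lemma card_filter_pair_cert_le {n d : ℕ} (hd : 2 ≤ d) {𝓖 : Finset (Finset (Fin n))}
    (hcard : ∀ F ∈ 𝓖, F.card = d + 1) {c : Finset (Fin n) → Finset (Fin n)}
    (hc : IsMaxCertAssignment 𝓖 c) (hcd : ∀ F ∈ 𝓖, d - 1 ≤ (c F).card ∧ (c F).card ≤ d)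
    {i j : Fin n} (hij : i ≠ j) :
    (𝓖.filter (fun F => i ∈ F ∧ j ∈ F ∧ (c F \ {i, j}).card ≤ d - 2)).card
      ≤ (𝓖.filter (fun F => i ∈ F ∧ (c F).card = d - 1)).card + n ^ (d - 2) := by
  set P := 𝓖.filter (fun F => (c F).card = d ∧ {i, j} ⊆ c F) with hP
  have hsub : 𝓖.filter (fun F => i ∈ F ∧ j ∈ F ∧ (c F \ {i, j}).card ≤ d - 2) ⊆
      𝓖.filter (fun F => i ∈ F ∧ (c F).card = d - 1) ∪ P := by
    intro F hF
    obtain ⟨hFG, hi, -, hle⟩ := mem_filter.1 hF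
    rw [mem_union, hP, mem_filter, mem_filter]
    by_cases hk : (c F).card = d - 1
    · exact Or.inl ⟨hFG, hi, hk⟩
    · have hk' : (c F).card = d := by have := hcd F hFG; omega
      refine Or.inr ⟨hFG, hk', ?_⟩
      have h1 := card_sdiff_add_card_inter (c F) {i, j}
      have h2 : c F ∩ {i, j} = {i, j} :=
        eq_of_subset_of_card_le inter_subset_right (by rw [card_pair hij]; omega)
      exact inter_eq_right.1 h2
  have hPc : P.card ≤ n ^ (d - 2) := by
    refine le_trans (card_le_card_of_injOn c ?_ ?_) (card_filter_superset_pair_le (d := d) hij)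
    · intro F hF
      have := (mem_filter.1 hF).2
      simpa using this
    · refine (injOn_cert_of_card_eq hcard hc).mono fun F hF => ?_
      have := mem_filter.1 hF
      exact ⟨this.1, this.2.1⟩
  exact (card_le_card hsub).trans ((card_union_le _ _).trans (by omega))

/-- Two points of small degree are avoided by most members of a family. -/
lemma le_card_filter_disjoint_pair {n d : ℕ} (hn : 0 < n) (S : Finset (Finset (Fin n)))
    {i j : Fin n} (hi : n * (S.filter (fun D => i ∈ D)).card ≤ 4 * d * S.card)
    (hj : n * (S.filter (fun D => j ∈ D)).card ≤ 4 * d * S.card) :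
    ((S.filter (fun D => D ∩ {i, j} = ∅)).card : ℝ) ≥ (1 - 8 * d / n) * (S.card : ℝ) := by
  have hsub : S ⊆ S.filter (fun D => D ∩ {i, j} = ∅) ∪
      (S.filter (fun D => i ∈ D) ∪ S.filter (fun D => j ∈ D)) := by
    intro D hD
    simp only [mem_union, mem_filter, hD, true_and]
    by_contra! h
    obtain ⟨x, hx⟩ := h.1
    grind
  have h1 := (card_le_card hsub).trans
    ((card_union_le _ _).trans (Nat.add_le_add_left (card_union_le _ _) _))
  have hn' : (0 : ℝ) < n := by exact_mod_cast hn
  have h1' : (S.card : ℝ) ≤ (S.filter (fun D => D ∩ {i, j} = ∅)).card +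
      ((S.filter (fun D => i ∈ D)).card + (S.filter (fun D => j ∈ D)).card) := by
    exact_mod_cast h1
  have hi' : (n : ℝ) * (S.filter (fun D => i ∈ D)).card ≤ 4 * d * S.card := by exact_mod_cast hi
  have hj' : (n : ℝ) * (S.filter (fun D => j ∈ D)).card ≤ 4 * d * S.card := by exact_mod_cast hj
  refine le_of_mul_le_mul_left (a := (n : ℝ)) ?_ hn'
  have e : (n : ℝ) * ((1 - 8 * d / n) * S.card) = n * S.card - 8 * d * S.card := by
    field_simp
  rw [e]
  nlinarith

theorem stmt10 (d : ℕ) (hd : 2 ≤ d) :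
    ∃ C : ℕ, ∃ n₀ : ℕ, ∀ n : ℕ, n₀ ≤ n →
      ∀ 𝓕 𝓖 : Finset (Finset (Fin n)), (∀ F ∈ 𝓕, F.card = d + 1) → VCDimLE 𝓕 d →
        𝓖 ⊆ 𝓕 →
        ∀ c : Finset (Fin n) → Finset (Fin n), IsMaxCertAssignment 𝓖 c →
          (∀ F ∈ 𝓖, d - 1 ≤ (c F).card ∧ (c F).card ≤ d) →
          ∃ i j : Fin n, i ≠ j ∧
            -- (i)
            ((((compShadow d 𝓖).filter (fun D => D ∩ {i, j} = ∅)).card : ℝ) ≥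
              (1 - 8 * d / n) * ((compShadow d 𝓖).card : ℝ)) ∧
            -- (ii)
            (𝓖.filter (fun F => i ∈ F ∧ (c F).card = d - 1)).card ≤ C * n ^ (d - 2) ∧
            (𝓖.filter (fun F => j ∈ F ∧ (c F).card = d - 1)).card ≤ C * n ^ (d - 2) ∧
            (𝓖.filter (fun F => i ∈ F ∧ j ∈ F ∧ (c F \ {i, j}).card ≤ d - 2)).card
              ≤ C * n ^ (d - 2) := by
  set K := (d + 1) * 2 ^ (3 * (d + 1)) with hK
  refine ⟨4 * K + 1, 4, ?_⟩
  intro n hn 𝓕 𝓖 h𝓕 _ hsub c hc hcd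
  have hcard : ∀ F ∈ 𝓖, F.card = d + 1 := fun F hF => h𝓕 F (hsub hF)
  have hpow : n * n ^ (d - 2) = n ^ (d - 1) := by
    rw [← pow_succ']; congr 1; omega
  set S := compShadow d 𝓖 with hS
  have hScard : ∀ D ∈ S, D.card = d := fun D hD =>
    (mem_powersetCard.1 (mem_sdiff.1 hD).1).2
  set f : Fin n → ℕ := fun i => (𝓖.filter (fun F => i ∈ F ∧ (c F).card = d - 1)).card with hf
  set g : Fin n → ℕ := fun i => n * (S.filter (fun D => i ∈ D)).card with hg
  have hB₁ := four_mul_card_filter_lt_le f (4 * K * n ^ (d - 2)) (by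
    have h1 := sum_card_filter_mem (𝓖.filter (fun F => (c F).card = d - 1)) (k := d + 1)
      fun F hF => hcard F (mem_filter.1 hF).1
    simp only [filter_filter, and_comm (a := _ = d - 1)] at h1
    rw [hf, h1]
    have h2 := Nat.mul_le_mul_left (4 * (d + 1))
      (card_filter_card_cert_eq_le (by omega) hcard hc)
    calc _ = 4 * (d + 1) * (𝓖.filter (fun F => (c F).card = d - 1)).card := by ring
      _ ≤ _ := h2
      _ = _ := by rw [← hpow, hK]; ring)
  have hB₂ := four_mul_card_filter_lt_le g (4 * d * S.card) (by
    rw [hg, ← mul_sum, sum_card_filter_mem S hScard]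
    exact le_of_eq (by ring))
  set B := univ.filter (fun i => 4 * K * n ^ (d - 2) < f i) ∪
    univ.filter (fun i => 4 * d * S.card < g i) with hB
  have hBc : 1 < Bᶜ.card := by
    have := card_union_le (univ.filter (fun i => 4 * K * n ^ (d - 2) < f i))
      (univ.filter (fun i => 4 * d * S.card < g i))
    rw [← hB] at this
    rw [card_compl, Fintype.card_fin]
    omega
  obtain ⟨i, hi, j, hj, hij⟩ := one_lt_card.1 hBc
  simp only [hB, mem_compl, mem_union, mem_filter, mem_univ, true_and, not_or, not_lt] at hi hj
  have hpair := card_filter_pair_cert_le hd hcard hc hcd hij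
  have hexp : (4 * K + 1) * n ^ (d - 2) = 4 * K * n ^ (d - 2) + n ^ (d - 2) := by ring
  rw [hexp]
  exact ⟨i, j, hij, le_card_filter_disjoint_pair (by omega) S hi.2 hj.2,
    hi.1.trans (Nat.le_add_right _ _), hj.1.trans (Nat.le_add_right _ _),
    hpair.trans (Nat.add_le_add_right hi.1 _)⟩
end
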